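/- There is an absolute constant C such that the following holds. Let 𝒬 ∪ ℒ be a finite set of pairwise linearly independent homogeneous quadratic polynomials in ℂ[x_1, …, x_n] such that for every two distinct elements P_1, P_2 of 𝒬 ∪ ℒ there exists a third element of 𝒬 ∪ ℒ vanishing at every common zero of P_1 and P_2, where every element of 𝒬 is irreducible and every element of ℒ is the square of a linear form. Set m = |𝒬|. Call Q ∈ 𝒬 bad if there are fewer than m/100 pairs (A, B) ∈ 𝒬 × 𝒬 such that Q, A, B are pairwise distinct and B lies in the ℂ-linear span of Q and A. If 𝒬 contains at least two bad polynomials Q_1 and Q_2, then there exists a ℂ-subspace V of the space of linear forms with dim V ≤ C such that every polynomial in 𝒬 is a ℂ-linear combination of Q_1 and a quadratic over V. -/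

import Mathlib

open MvPolynomial
open scoped Classical

/-- `Q` is *bad* in `𝒬`: there are fewer than `|𝒬|/100` pairs `(A, B) ∈ 𝒬 × 𝒬` with
`Q, A, B` pairwise distinct and `B` in the linear span of `Q` and `A`. -/
def IsBad {n : ℕ} (Q : Finset (MvPolynomial (Fin n) ℂ)) (P : MvPolynomial (Fin n) ℂ) :
    Prop :=
  (((Q ×ˢ Q).filter (fun AB => P ≠ AB.1 ∧ P ≠ AB.2 ∧ AB.1 ≠ AB.2 ∧
      AB.2 ∈ Submodule.span ℂ ({P, AB.1} : Set (MvPolynomial (Fin n) ℂ)))).card : ℝ) <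
    (Q.card : ℝ) / 100

namespace QuadraticSG

variable {n : ℕ}

/-- An irreducible polynomial divides every polynomial vanishing on its zero set. -/
lemma dvd_of_vanish {p f : MvPolynomial (Fin n) ℂ} (hp : Irreducible p)
    (h : ∀ a, eval a p = 0 → eval a f = 0) : p ∣ f := by
  have hprime : (Ideal.span {p}).IsPrime :=
    (Ideal.span_singleton_prime hp.ne_zero).2 hp.prime
  have h1 := MvPolynomial.IsPrime.vanishingIdeal_zeroLocus (K := ℂ) (Ideal.span {p})
  have h2 : f ∈ Ideal.span {p} := by
    rw [← h1, mem_vanishingIdeal_iff]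
    intro x hx
    rw [mem_zeroLocus_iff] at hx
    have := hx p (Ideal.mem_span_singleton_self p)
    rw [aeval_eq_eval] at this ⊢
    exact h x this
  exact Ideal.mem_span_singleton.1 h2

lemma isHomogeneous_of_mul {p g : MvPolynomial (Fin n) ℂ} {a b : ℕ} (hp : p.IsHomogeneous a)
    (hp0 : p ≠ 0) (h : (p * g).IsHomogeneous (a + b)) : g.IsHomogeneous b := by
  let _ : GradedAlgebra (homogeneousSubmodule (Fin n) ℂ) := MvPolynomial.gradedAlgebra
  have key : ∀ i, i ≠ b → homogeneousComponent i g = 0 := by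
    intro i hi
    have h1 : (DirectSum.decompose (homogeneousSubmodule (Fin n) ℂ) (p * g) (a + i) :
        MvPolynomial (Fin n) ℂ) = p * DirectSum.decompose (homogeneousSubmodule (Fin n) ℂ) g i :=
      DirectSum.coe_decompose_mul_add_of_left_mem _ hp
    have h2 : (DirectSum.decompose (homogeneousSubmodule (Fin n) ℂ) (p * g) (a + i) :
        MvPolynomial (Fin n) ℂ) = 0 :=
      DirectSum.decompose_of_mem_ne _ h (by omega)
    rw [h2] at h1
    have h3 := (mul_eq_zero.1 h1.symm).resolve_left hp0
    rw [← h3]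
    exact (decomposition.decompose'_apply g i).symm
  have h4 := sum_homogeneousComponent g
  have h5 : g = homogeneousComponent b g := by
    conv_lhs => rw [← h4]
    by_cases hb : b ∈ Finset.range (g.totalDegree + 1)
    · exact Finset.sum_eq_single_of_mem b hb (fun i _ hi => key i hi)
    · rw [Finset.sum_eq_zero, homogeneousComponent_eq_zero]
      · simpa using hb
      · intro i hi
        exact key i (fun h => hb (h ▸ hi))
  rw [h5]
  exact homogeneousComponent_isHomogeneous b g

lemma eq_zero_of_degree_lt {p f g : MvPolynomial (Fin n) ℂ} {a b : ℕ} (hp : p.IsHomogeneous a)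
    (hf : f.IsHomogeneous b) (hba : b < a) (h : f = p * g) : f = 0 := by
  by_contra hf0
  have hp0 : p ≠ 0 := fun h0 => hf0 (by rw [h, h0, zero_mul])
  have hg0 : g ≠ 0 := fun h0 => hf0 (by rw [h, h0, mul_zero])
  have h1 := totalDegree_mul_of_isDomain hp0 hg0
  rw [← h, hf.totalDegree hf0, hp.totalDegree hp0] at h1
  omega

lemma eq_C_of_isHomogeneous_zero {g : MvPolynomial (Fin n) ℂ} (h : g.IsHomogeneous 0) :
    ∃ c : ℂ, g = C c :=
  ⟨_, totalDegree_eq_zero_iff_eq_C.1 ((totalDegree_zero_iff_isHomogeneous _).2 h)⟩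

lemma exists_C_of_dvd {p f : MvPolynomial (Fin n) ℂ} {a : ℕ} (hp : p.IsHomogeneous a)
    (hp0 : p ≠ 0) (hf : f.IsHomogeneous a) (h : p ∣ f) : ∃ c : ℂ, f = C c * p := by
  obtain ⟨g, rfl⟩ := h
  obtain ⟨c, rfl⟩ := eq_C_of_isHomogeneous_zero (isHomogeneous_of_mul (b := 0) hp hp0 hf)
  exact ⟨c, mul_comm _ _⟩

lemma irreducible_linear {l : MvPolynomial (Fin n) ℂ} (hl : l.IsHomogeneous 1) (h0 : l ≠ 0) :
    Irreducible l := by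
  apply irreducible_of_totalDegree_eq_one (hl.totalDegree h0)
  intro x hx
  by_contra hxu
  have : x = 0 := by by_contra h; exact hxu (isUnit_iff_ne_zero.2 h)
  subst this
  apply h0
  ext d
  simpa using hx d

lemma exists_linear_factors {f : MvPolynomial (Fin n) ℂ} (hf : f.IsHomogeneous 2) (h0 : f ≠ 0)
    (h : ¬ Irreducible f) :
    ∃ s t : MvPolynomial (Fin n) ℂ, s.IsHomogeneous 1 ∧ t.IsHomogeneous 1 ∧ f = s * t := by
  have hu : ¬ IsUnit f := by
    intro hu
    have := (MvPolynomial.isUnit_iff_eq_C_of_isReduced.1 hu)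
    obtain ⟨r, -, rfl⟩ := this
    have := (isHomogeneous_C (Fin n) r).inj_right hf h0
    omega
  rw [irreducible_iff] at h
  push Not at h
  obtain ⟨s, t, hst, hs, ht⟩ := h hu
  have hs0 : s ≠ 0 := by rintro rfl; exact h0 (by rw [hst, zero_mul])
  have ht0 : t ≠ 0 := by rintro rfl; exact h0 (by rw [hst, mul_zero])
  have hd := totalDegree_mul_of_isDomain hs0 ht0
  rw [← hst, hf.totalDegree h0] at hd
  have hpos : ∀ g : MvPolynomial (Fin n) ℂ, g ≠ 0 → ¬ IsUnit g → g.totalDegree ≠ 0 := by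
    intro g hg0 hg hd
    obtain ⟨c, hc⟩ := eq_C_of_isHomogeneous_zero ((totalDegree_zero_iff_isHomogeneous _).1 hd)
    apply hg
    rw [hc]
    refine IsUnit.map C (isUnit_iff_ne_zero.2 ?_)
    rintro rfl
    exact hg0 (by simpa using hc)
  have h1 := hpos s hs0 hs
  have h2 := hpos t ht0 ht
  have key : ∀ g : MvPolynomial (Fin n) ℂ, g.totalDegree = 1 →
      g = homogeneousComponent 0 g + homogeneousComponent 1 g := by
    intro g hg
    have := sum_homogeneousComponent g
    rw [hg, Finset.sum_range_succ, Finset.sum_range_one] at this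
    exact this.symm
  have ks := key s (by omega)
  have kt := key t (by omega)
  have hs1 := homogeneousComponent_isHomogeneous 1 s
  have ht1 := homogeneousComponent_isHomogeneous 1 t
  have hs2 := homogeneousComponent_isHomogeneous 0 s
  have ht2 := homogeneousComponent_isHomogeneous 0 t
  refine ⟨_, _, hs1, ht1, ?_⟩
  set s1 := homogeneousComponent 1 s
  set t1 := homogeneousComponent 1 t
  set s0 := homogeneousComponent 0 s
  set t0 := homogeneousComponent 0 t
  have e : f = s0 * t0 + (s0 * t1 + s1 * t0) + s1 * t1 := by rw [hst, ks, kt]; ring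
  have e2 : homogeneousComponent 2 f = f := by
    rw [homogeneousComponent_of_mem hf]; simp
  rw [← e2, e, map_add, map_add, map_add,
    homogeneousComponent_of_mem (show s0 * t0 ∈ _ from hs2.mul ht2),
    homogeneousComponent_of_mem (show s0 * t1 ∈ _ from hs2.mul ht1),
    homogeneousComponent_of_mem (show s1 * t0 ∈ _ from hs1.mul ht2),
    homogeneousComponent_of_mem (show s1 * t1 ∈ _ from hs1.mul ht1)]
  simp

lemma lin_eval {l : MvPolynomial (Fin n) ℂ} (hl : l.IsHomogeneous 1) (a e : Fin n → ℂ) (t : ℂ) :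
    eval (a + t • e) l = eval a l + t * eval e l := by
  replace hl : l ∈ homogeneousSubmodule (Fin n) ℂ 1 := hl
  rw [homogeneousSubmodule_one_eq_span_X] at hl
  induction hl using Submodule.span_induction with
  | mem x h => obtain ⟨i, rfl⟩ := h; simp
  | zero => simp
  | add x y _ _ hx hy => simp only [map_add, hx, hy]; ring
  | smul c x _ hx => simp only [smul_eval, hx]; ring

lemma quad_induction {M : MvPolynomial (Fin n) ℂ → Prop} (h0 : ∀ P Q, M P → M Q → M (P + Q))
    (h1 : ∀ l m : MvPolynomial (Fin n) ℂ, l.IsHomogeneous 1 → m.IsHomogeneous 1 → M (l * m))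
    {P : MvPolynomial (Fin n) ℂ} (hP : P.IsHomogeneous 2) : M P := by
  replace hP : P ∈ homogeneousSubmodule (Fin n) ℂ 2 := hP
  rw [← homogeneousSubmodule_one_pow, pow_two] at hP
  exact Submodule.mul_induction_on hP (fun m hm l hl => h1 m l hm hl) h0

/-- The directional derivative of `P` in the direction `e`. -/
noncomputable def dirDeriv (P : MvPolynomial (Fin n) ℂ) :
    (Fin n → ℂ) →ₗ[ℂ] MvPolynomial (Fin n) ℂ where
  toFun e := ∑ i, C (e i) * pderiv i P
  map_add' e f := by simp [add_mul, Finset.sum_add_distrib]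
  map_smul' c e := by simp [Finset.smul_sum, smul_eq_C_mul, mul_assoc]

lemma dirDeriv_apply (P : MvPolynomial (Fin n) ℂ) (e : Fin n → ℂ) :
    dirDeriv P e = ∑ i, C (e i) * pderiv i P := rfl

lemma dirDeriv_add (P Q : MvPolynomial (Fin n) ℂ) (e : Fin n → ℂ) :
    dirDeriv (P + Q) e = dirDeriv P e + dirDeriv Q e := by
  simp [dirDeriv_apply, mul_add, Finset.sum_add_distrib]

lemma dirDeriv_sub (P Q : MvPolynomial (Fin n) ℂ) (e : Fin n → ℂ) :
    dirDeriv (P - Q) e = dirDeriv P e - dirDeriv Q e := by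
  simp [dirDeriv_apply, mul_sub, Finset.sum_sub_distrib]

lemma dirDeriv_mul (P Q : MvPolynomial (Fin n) ℂ) (e : Fin n → ℂ) :
    dirDeriv (P * Q) e = P * dirDeriv Q e + dirDeriv P e * Q := by
  simp only [dirDeriv_apply, Finset.mul_sum, Finset.sum_mul, ← Finset.sum_add_distrib,
    Derivation.leibniz, smul_eq_mul]
  exact Finset.sum_congr rfl fun i _ => by ring

lemma dirDeriv_C (c : ℂ) (e : Fin n → ℂ) :
    dirDeriv (C c : MvPolynomial (Fin n) ℂ) e = 0 := by
  simp [dirDeriv_apply]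

lemma dirDeriv_C_mul (c : ℂ) (P : MvPolynomial (Fin n) ℂ) (e : Fin n → ℂ) :
    dirDeriv (C c * P) e = C c * dirDeriv P e := by
  rw [dirDeriv_mul, dirDeriv_C]; ring

lemma dirDeriv_linear {l : MvPolynomial (Fin n) ℂ} (hl : l.IsHomogeneous 1) (e : Fin n → ℂ) :
    dirDeriv l e = C (eval e l) := by
  replace hl : l ∈ homogeneousSubmodule (Fin n) ℂ 1 := hl
  rw [homogeneousSubmodule_one_eq_span_X] at hl
  induction hl using Submodule.span_induction with
  | mem x h =>
    obtain ⟨i, rfl⟩ := h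
    simp [dirDeriv_apply, pderiv_X, Pi.single_apply]
  | zero => simpa using dirDeriv_C (n := n) 0 e
  | add x y _ _ hx hy => rw [dirDeriv_add, hx, hy]; simp
  | smul c x _ hx => rw [smul_eq_C_mul, dirDeriv_C_mul, hx]; simp

lemma dirDeriv_linear_mul {l m : MvPolynomial (Fin n) ℂ} (hl : l.IsHomogeneous 1)
    (hm : m.IsHomogeneous 1) (e : Fin n → ℂ) :
    dirDeriv (l * m) e = C (eval e m) * l + C (eval e l) * m := by
  rw [dirDeriv_mul, dirDeriv_linear hl, dirDeriv_linear hm]; ring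

lemma dirDeriv_isHomogeneous {P : MvPolynomial (Fin n) ℂ} (hP : P.IsHomogeneous 2)
    (e : Fin n → ℂ) : (dirDeriv P e).IsHomogeneous 1 := by
  refine quad_induction (M := fun P => (dirDeriv P e).IsHomogeneous 1) ?_ ?_ hP
  · intro P Q hP hQ; rw [dirDeriv_add]; exact hP.add hQ
  · intro l m hl hm; rw [dirDeriv_linear_mul hl hm]
    exact (hl.C_mul _).add (hm.C_mul _)

lemma quad_eval {P : MvPolynomial (Fin n) ℂ} (hP : P.IsHomogeneous 2) (a e : Fin n → ℂ) (t : ℂ) :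
    eval (a + t • e) P = eval a P + t * eval a (dirDeriv P e) + t ^ 2 * eval e P := by
  refine quad_induction (M := fun P => eval (a + t • e) P =
    eval a P + t * eval a (dirDeriv P e) + t ^ 2 * eval e P) ?_ ?_ hP
  · intro P Q hP hQ; simp only [dirDeriv_add, map_add, hP, hQ]; ring
  · intro l m hl hm
    simp only [dirDeriv_linear_mul hl hm, map_add, map_mul, eval_C, lin_eval hl, lin_eval hm]; ring

lemma eval_dirDeriv_comm {P : MvPolynomial (Fin n) ℂ} (hP : P.IsHomogeneous 2)
    (a e : Fin n → ℂ) : eval a (dirDeriv P e) = eval e (dirDeriv P a) := by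
  refine quad_induction (M := fun P => eval a (dirDeriv P e) = eval e (dirDeriv P a)) ?_ ?_ hP
  · intro P Q hP hQ; simp only [dirDeriv_add, map_add, hP, hQ]
  · intro l m hl hm
    simp only [dirDeriv_linear_mul hl hm, map_add, map_mul, eval_C]; ring

lemma eval_dirDeriv_self {P : MvPolynomial (Fin n) ℂ} (hP : P.IsHomogeneous 2)
    (e : Fin n → ℂ) : eval e (dirDeriv P e) = 2 * eval e P := by
  refine quad_induction (M := fun P => eval e (dirDeriv P e) = 2 * eval e P) ?_ ?_ hP
  · intro P Q hP hQ; simp only [dirDeriv_add, map_add, hP, hQ]; ring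
  · intro l m hl hm
    simp only [dirDeriv_linear_mul hl hm, map_add, map_mul, eval_C]; ring

/-- Substitution projecting along `u` onto the hyperplane `a = 0` (when `a u = 1`). -/
noncomputable def projAlong (a : MvPolynomial (Fin n) ℂ) (u : Fin n → ℂ) :
    MvPolynomial (Fin n) ℂ →ₐ[ℂ] MvPolynomial (Fin n) ℂ :=
  aeval fun i => X i - C (u i) * a

lemma projAlong_isHomogeneous {a : MvPolynomial (Fin n) ℂ} (ha : a.IsHomogeneous 1)
    (u : Fin n → ℂ) {f : MvPolynomial (Fin n) ℂ} {k : ℕ} (hf : f.IsHomogeneous k) :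
    (projAlong a u f).IsHomogeneous k := by
  have := hf.aeval (fun i => X i - C (u i) * a) (n := 1)
    (fun i => (isHomogeneous_X _ i).sub (ha.C_mul _))
  rwa [one_mul] at this

lemma eval_projAlong (a : MvPolynomial (Fin n) ℂ) (u p : Fin n → ℂ)
    (f : MvPolynomial (Fin n) ℂ) :
    eval p (projAlong a u f) = eval (p + (- eval p a) • u) f := by
  induction f using MvPolynomial.induction_on with
  | C c => simp [projAlong]
  | add f g hf hg => simp [hf, hg]
  | mul_X f i hf =>
    rw [map_mul, map_mul, hf, map_mul]
    congr 1
    simp [projAlong]; ring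

lemma dvd_sub_projAlong (a : MvPolynomial (Fin n) ℂ) (u : Fin n → ℂ)
    (f : MvPolynomial (Fin n) ℂ) : a ∣ f - projAlong a u f := by
  induction f using MvPolynomial.induction_on with
  | C c => simp [projAlong]
  | add f g hf hg =>
    rw [map_add]
    have : f + g - (projAlong a u f + projAlong a u g) =
      (f - projAlong a u f) + (g - projAlong a u g) := by ring
    rw [this]; exact dvd_add hf hg
  | mul_X f i hf =>
    rw [map_mul]
    have h2 : projAlong a u (X i) = X i - C (u i) * a := by simp [projAlong]
    rw [h2]
    have : f * X i - projAlong a u f * (X i - C (u i) * a) =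
      (f - projAlong a u f) * X i + a * (projAlong a u f * C (u i)) := by ring
    rw [this]
    exact dvd_add (hf.mul_right _) (dvd_mul_right _ _)

lemma projAlong_self {a : MvPolynomial (Fin n) ℂ} (ha : a.IsHomogeneous 1) {u : Fin n → ℂ}
    (hu : eval u a = 1) : projAlong a u a = 0 := by
  apply MvPolynomial.funext
  intro p
  rw [eval_projAlong, lin_eval ha, hu]; simp

lemma exists_eval_eq_one {a : MvPolynomial (Fin n) ℂ} (ha : a.IsHomogeneous 1) (h0 : a ≠ 0) :
    ∃ u, eval u a = 1 := by
  have : ∃ p, eval p a ≠ 0 := by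
    by_contra h; push Not at h
    exact h0 (MvPolynomial.funext fun p => by simpa using h p)
  obtain ⟨p, hp⟩ := this
  refine ⟨0 + (eval p a)⁻¹ • p, ?_⟩
  rw [lin_eval ha]
  have : eval 0 a = 0 := by
    have := lin_eval ha 0 0 1
    simpa using this
  rw [this, inv_mul_cancel₀ hp, zero_add]

/-- Reduction modulo a linear form, phrased as an endomorphism of the polynomial ring. -/
lemma exists_reduction {a : MvPolynomial (Fin n) ℂ} (ha : a.IsHomogeneous 1) (h0 : a ≠ 0) :
    ∃ φ : MvPolynomial (Fin n) ℂ →ₐ[ℂ] MvPolynomial (Fin n) ℂ,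
      (∀ k f, f.IsHomogeneous k → (φ f).IsHomogeneous k) ∧ (∀ f, a ∣ f - φ f) ∧
      (∀ f, φ f = 0 ↔ a ∣ f) ∧
      ∀ p : Fin n → ℂ, ∃ q : Fin n → ℂ, eval q a = 0 ∧ ∀ f, eval p (φ f) = eval q f := by
  obtain ⟨u, hu⟩ := exists_eval_eq_one ha h0
  refine ⟨projAlong a u, fun k f hf => projAlong_isHomogeneous ha u hf, dvd_sub_projAlong a u,
    fun f => ⟨fun h => ?_, ?_⟩, fun p => ⟨p + (- eval p a) • u, ?_, eval_projAlong a u p⟩⟩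
  · have := dvd_sub_projAlong a u f
    rwa [h, sub_zero] at this
  · rintro ⟨g, rfl⟩
    rw [map_mul, projAlong_self ha hu, zero_mul]
  · rw [lin_eval ha, hu]; ring

lemma exists_linear_of_dvd {l f : MvPolynomial (Fin n) ℂ} (hl : l.IsHomogeneous 1) (h0 : l ≠ 0)
    (hf : f.IsHomogeneous 2) (h : l ∣ f) :
    ∃ y : MvPolynomial (Fin n) ℂ, y.IsHomogeneous 1 ∧ f = l * y := by
  obtain ⟨y, rfl⟩ := h
  exact ⟨y, isHomogeneous_of_mul (b := 1) hl h0 hf, rfl⟩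

lemma not_dvd_linear {A l : MvPolynomial (Fin n) ℂ} (hA : A.IsHomogeneous 2)
    (hl : l.IsHomogeneous 1) (h0 : l ≠ 0) : ¬ A ∣ l := by
  rintro ⟨g, hg⟩
  exact h0 (eq_zero_of_degree_lt hA hl (by norm_num) hg)

lemma not_irreducible_mul {l m : MvPolynomial (Fin n) ℂ} (hl : l.IsHomogeneous 1)
    (hm : m.IsHomogeneous 1) : ¬ Irreducible (l * m) := by
  intro h
  have key : ∀ f : MvPolynomial (Fin n) ℂ, f.IsHomogeneous 1 → ¬ IsUnit f := by
    intro f hf hu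
    obtain ⟨r, hr, rfl⟩ := MvPolynomial.isUnit_iff_eq_C_of_isReduced.1 hu
    have := (isHomogeneous_C (Fin n) r).inj_right hf hu.ne_zero
    omega
  rcases h.isUnit_or_isUnit rfl with h | h
  · exact key _ hl h
  · exact key _ hm h

/-- Two quadrics, one of which is invariant under translation by `e` and the other of which does
not vanish at `e`. -/
lemma span_or_square_of_eval_ne_zero {A P R : MvPolynomial (Fin n) ℂ} (hA : A.IsHomogeneous 2)
    (hP : P.IsHomogeneous 2) (hR : R.IsHomogeneous 2) (hAi : Irreducible A)
    (hV : ∀ a, eval a A = 0 → eval a P = 0 → eval a R = 0) {e : Fin n → ℂ}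
    (he : dirDeriv A e = 0) (hPe : eval e P ≠ 0) :
    (∃ α β : ℂ, R = C α * A + C β * P) ∨
      ∃ (γ : ℂ) (x : MvPolynomial (Fin n) ℂ), x.IsHomogeneous 1 ∧ P = C γ * A + x ^ 2 := by
  have hAe : eval e A = 0 := by
    have := eval_dirDeriv_self hA e
    rw [he, map_zero] at this
    simpa using this.symm
  set c := eval e P with hc
  obtain ⟨R', hR'⟩ : ∃ R', R' = R - C (eval e R / c) * P := ⟨_, rfl⟩
  have hR'h : R'.IsHomogeneous 2 := by rw [hR']; exact hR.sub (hP.C_mul _)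
  have hR'e : eval e R' = 0 := by
    rw [hR']; simp only [map_sub, map_mul, eval_C, ← hc]; field_simp; ring
  have hL := dirDeriv_isHomogeneous hR'h e
  set L := dirDeriv R' e
  obtain ⟨x, hx⟩ : ∃ x, x = C (1 / (2 * c)) * dirDeriv P e := ⟨_, rfl⟩
  have hxh : x.IsHomogeneous 1 := by rw [hx]; exact (dirDeriv_isHomogeneous hP e).C_mul _
  have hxP : ∀ a, eval a (dirDeriv P e) = 2 * c * eval a x := by
    intro a; rw [hx]; simp only [map_mul, eval_C]; field_simp
  have key : ∀ a, eval a A = 0 → ∀ s : ℂ, c * s ^ 2 = - (eval a P - c * (eval a x) ^ 2) →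
      eval a R' + (s - eval a x) * eval a L = 0 := by
    intro a ha s hs
    have h1 : eval (a + (s - eval a x) • e) A = 0 := by
      rw [quad_eval hA, he, ha, hAe]; simp
    have h2 : eval (a + (s - eval a x) • e) P = 0 := by
      rw [quad_eval hP, hxP, ← hc]; linear_combination hs
    have h3 : eval (a + (s - eval a x) • e) R' = 0 := by
      rw [hR']; simp only [map_sub, map_mul, hV _ h1 h2, h2]; ring
    rw [quad_eval hR'h, hR'e] at h3
    linear_combination h3
  have key2 : ∀ a, eval a A = 0 → ∃ s : ℂ, c * s ^ 2 = - (eval a P - c * (eval a x) ^ 2) ∧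
      s * eval a L = 0 ∧ eval a R' - eval a x * eval a L = 0 := by
    intro a ha
    obtain ⟨s, hs⟩ := IsAlgClosed.exists_pow_nat_eq
      (- (eval a P - c * (eval a x) ^ 2) / c) (n := 2) (by norm_num)
    have hs' : c * s ^ 2 = - (eval a P - c * (eval a x) ^ 2) := by rw [hs]; field_simp
    have h1 := key a ha s hs'
    have h2 := key a ha (-s) (by rw [← hs']; ring)
    exact ⟨s, hs', by linear_combination (h1 - h2) / 2, by linear_combination (h1 + h2) / 2⟩
  have d1 : A ∣ R' - x * L := dvd_of_vanish hAi fun a ha => by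
    obtain ⟨s, -, -, h⟩ := key2 a ha
    simpa using h
  have d2 : A ∣ (P - C c * x ^ 2) * L := dvd_of_vanish hAi fun a ha => by
    obtain ⟨s, h1, h2, -⟩ := key2 a ha
    simp only [map_mul, map_sub, map_pow, eval_C]
    linear_combination eval a L * h1 - c * s * h2
  rcases hAi.prime.dvd_or_dvd d2 with h | h
  · right
    obtain ⟨γ, hγ⟩ := exists_C_of_dvd hA hAi.ne_zero
      (hP.sub (IsHomogeneous.C_mul (hxh.pow 2) c)) h
    obtain ⟨r, hr⟩ := IsAlgClosed.exists_pow_nat_eq c (n := 2) (by norm_num)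
    refine ⟨γ, C r * x, hxh.C_mul _, ?_⟩
    rw [mul_pow, ← map_pow, hr]
    linear_combination hγ
  · left
    have hL0 : L = 0 := by
      by_contra h0
      exact not_dvd_linear hA hL h0 h
    rw [hL0, mul_zero, sub_zero] at d1
    obtain ⟨α, hα⟩ := exists_C_of_dvd hA hAi.ne_zero hR'h d1
    exact ⟨α, _, by rw [← hα, hR']; ring⟩

/-- Two quadrics, one of which is invariant under translation by `e` and the other of which
vanishes at `e` but is not invariant. -/
lemma span_or_reducible_or_ideal {A P R : MvPolynomial (Fin n) ℂ} (hA : A.IsHomogeneous 2)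
    (hP : P.IsHomogeneous 2) (hR : R.IsHomogeneous 2) (hAi : Irreducible A)
    (hV : ∀ a, eval a A = 0 → eval a P = 0 → eval a R = 0) {e : Fin n → ℂ}
    (he : dirDeriv A e = 0) (hPe : eval e P = 0) (hne : dirDeriv P e ≠ 0) :
    (∃ α β : ℂ, R = C α * A + C β * P) ∨
      (∃ (κ : ℂ) (y : MvPolynomial (Fin n) ℂ), y.IsHomogeneous 1 ∧
        P = C κ * A + dirDeriv P e * y) ∨
      ∃ M k h z : MvPolynomial (Fin n) ℂ, M.IsHomogeneous 1 ∧ k.IsHomogeneous 1 ∧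
        h.IsHomogeneous 1 ∧ z.IsHomogeneous 1 ∧ A = dirDeriv P e * z + dirDeriv R e * M ∧
        P = dirDeriv P e * h - M * k ∧ R = dirDeriv R e * h + z * k := by
  have hAe : eval e A = 0 := by
    have := eval_dirDeriv_self hA e
    rw [he, map_zero] at this
    simpa using this.symm
  have hRe : eval e R = 0 := hV e hAe hPe
  have hL1 := dirDeriv_isHomogeneous hP e
  have hL3 := dirDeriv_isHomogeneous hR e
  set L1 := dirDeriv P e
  set L3 := dirDeriv R e
  have d1 : A ∣ L1 * (L1 * R - L3 * P) := dvd_of_vanish hAi fun a ha => by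
    by_cases h : eval a L1 = 0
    · simp [h]
    have h1 : eval (a + (- eval a P / eval a L1) • e) A = 0 := by
      rw [quad_eval hA, he, ha, hAe]; simp
    have h2 : eval (a + (- eval a P / eval a L1) • e) P = 0 := by
      rw [quad_eval hP, hPe]
      change eval a P + (- eval a P / eval a L1) * eval a L1 + _ = 0
      field_simp; ring
    have h3 := hV _ h1 h2
    rw [quad_eval hR, hRe] at h3
    change eval a R + (- eval a P / eval a L1) * eval a L3 + _ = 0 at h3
    field_simp at h3
    simp only [map_mul, map_sub]
    linear_combination h3
  obtain ⟨k, hk⟩ := (hAi.prime.dvd_or_dvd d1).resolve_left (not_dvd_linear hA hL1 hne)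
  by_cases hk0 : L1 ∣ L3
  · left
    obtain ⟨l, hl⟩ := exists_C_of_dvd hL1 hne hL3 hk0
    have : A ∣ L1 * (R - C l * P) := ⟨k, by rw [← hk, hl]; ring⟩
    have := (hAi.prime.dvd_or_dvd this).resolve_left (not_dvd_linear hA hL1 hne)
    obtain ⟨α, hα⟩ := exists_C_of_dvd hA hAi.ne_zero (hR.sub (hP.C_mul l)) this
    exact ⟨α, l, by linear_combination hα⟩
  right
  have hkh : k.IsHomogeneous 1 := by
    refine isHomogeneous_of_mul (b := 1) hA hAi.ne_zero ?_
    rw [← hk]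
    exact (hL1.mul hR).sub (hL3.mul hP)
  obtain ⟨φ, hφh, hφd, hφ0, -⟩ := exists_reduction hL1 hne
  have hφL1 : φ L1 = 0 := (hφ0 L1).2 dvd_rfl
  have hφL3 : φ L3 ≠ 0 := fun h => hk0 ((hφ0 L3).1 h)
  have hprime := (irreducible_linear (hφh 1 _ hL3) hφL3).prime
  have hφk : - (φ L3 * φ P) = φ A * φ k := by
    have := congrArg φ hk
    simp only [map_mul, map_sub, hφL1] at this
    linear_combination this
  have hdvd : φ L3 ∣ φ A * φ k := ⟨- φ P, by rw [← hφk]; ring⟩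
  rcases hprime.dvd_or_dvd hdvd with h | h
  · right
    obtain ⟨M, hM, hAM⟩ := exists_linear_of_dvd (hφh 1 _ hL3) hφL3 (hφh 2 _ hA) h
    have hPM : φ P = - (M * φ k) := by
      apply mul_left_cancel₀ hφL3
      rw [hAM] at hφk
      linear_combination - hφk
    have e1 : L1 ∣ A - L3 * M := by
      have : A - L3 * M = (A - φ A) - M * (L3 - φ L3) := by rw [hAM]; ring
      rw [this]
      exact dvd_sub (hφd A) ((hφd L3).mul_left _)
    have e2 : L1 ∣ P + M * k := by
      have : P + M * k = (P - φ P) + M * (k - φ k) := by rw [hPM]; ring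
      rw [this]
      exact dvd_add (hφd P) ((hφd k).mul_left _)
    obtain ⟨z, hz, hAz⟩ := exists_linear_of_dvd hL1 hne (hA.sub (hL3.mul hM)) e1
    obtain ⟨h, hh, hPh⟩ := exists_linear_of_dvd hL1 hne (hP.add (hM.mul hkh)) e2
    refine ⟨M, k, h, z, hM, hkh, hh, hz, by linear_combination hAz, by linear_combination hPh, ?_⟩
    apply mul_left_cancel₀ hne
    linear_combination hk + k * hAz + L3 * hPh
  · left
    obtain ⟨κ, hκ⟩ := exists_C_of_dvd (hφh 1 _ hL3) hφL3 (hφh 1 _ hkh) h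
    have hPM : φ P = - (C κ * φ A) := by
      apply mul_left_cancel₀ hφL3
      rw [hκ] at hφk
      linear_combination - hφk
    have e2 : L1 ∣ P + C κ * A := by
      have : P + C κ * A = (P - φ P) + C κ * (A - φ A) := by rw [hPM]; ring
      rw [this]
      exact dvd_add (hφd P) ((hφd A).mul_left _)
    obtain ⟨y, hy, hPy⟩ := exists_linear_of_dvd hL1 hne (hP.add (hA.C_mul κ)) e2
    refine ⟨-κ, y, hy, ?_⟩
    rw [map_neg]; linear_combination hPy

/-- `P` lies in the ideal generated by the linear forms `a` and `b`. -/
def InIdeal (a b P : MvPolynomial (Fin n) ℂ) : Prop :=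
  ∃ c d : MvPolynomial (Fin n) ℂ, c.IsHomogeneous 1 ∧ d.IsHomogeneous 1 ∧ P = a * c + b * d

/-- `P` and `Q` lie in a common ideal generated by two linear forms. -/
def CommonIdeal (P Q : MvPolynomial (Fin n) ℂ) : Prop :=
  ∃ a b : MvPolynomial (Fin n) ℂ, a.IsHomogeneous 1 ∧ b.IsHomogeneous 1 ∧
    InIdeal a b P ∧ InIdeal a b Q

lemma CommonIdeal.symm {P Q : MvPolynomial (Fin n) ℂ} (h : CommonIdeal P Q) :
    CommonIdeal Q P := by
  obtain ⟨a, b, ha, hb, h1, h2⟩ := h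
  exact ⟨a, b, ha, hb, h2, h1⟩

lemma InIdeal.add_C_mul {a b P Q : MvPolynomial (Fin n) ℂ} (hP : InIdeal a b P)
    (hQ : InIdeal a b Q) (α β : ℂ) : InIdeal a b (C α * P + C β * Q) := by
  obtain ⟨c, d, hc, hd, rfl⟩ := hP
  obtain ⟨c', d', hc', hd', rfl⟩ := hQ
  exact ⟨C α * c + C β * c', C α * d + C β * d', (hc.C_mul _).add (hc'.C_mul _),
    (hd.C_mul _).add (hd'.C_mul _), by ring⟩

/-- Reduction modulo one linear factor of a reducible member of a pencil. -/
lemma inIdeal_or_eq_of_vanish_on_hyperplane {Q l R : MvPolynomial (Fin n) ℂ}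
    (hQ : Q.IsHomogeneous 2) (hQi : Irreducible Q)
    (hl : l.IsHomogeneous 1) (hl0 : l ≠ 0) (hR : R.IsHomogeneous 2)
    (hV : ∀ a, eval a Q = 0 → eval a l = 0 → eval a R = 0) :
    (∃ s : MvPolynomial (Fin n) ℂ, s.IsHomogeneous 1 ∧ InIdeal l s Q) ∨
      ∃ (γ : ℂ) (m : MvPolynomial (Fin n) ℂ), m.IsHomogeneous 1 ∧ R = C γ * Q + l * m := by
  obtain ⟨φ, hφh, hφd, hφ0, hφe⟩ := exists_reduction hl hl0
  have hφQ : φ Q ≠ 0 := fun h => by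
    obtain ⟨m, hm, rfl⟩ := exists_linear_of_dvd hl hl0 hQ ((hφ0 Q).1 h)
    exact not_irreducible_mul hl hm hQi
  by_cases hi : Irreducible (φ Q)
  · right
    have : φ Q ∣ φ R := dvd_of_vanish hi fun p hp => by
      obtain ⟨q, hq, hqf⟩ := hφe p
      rw [hqf] at hp ⊢
      exact hV q hp hq
    obtain ⟨γ, hγ⟩ := exists_C_of_dvd (hφh 2 _ hQ) hφQ (hφh 2 _ hR) this
    have e : l ∣ R - C γ * Q := by
      have : R - C γ * Q = (R - φ R) - C γ * (Q - φ Q) := by rw [hγ]; ring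
      rw [this]
      exact dvd_sub (hφd R) ((hφd Q).mul_left _)
    obtain ⟨m, hm, h⟩ := exists_linear_of_dvd hl hl0 (hR.sub (hQ.C_mul γ)) e
    exact ⟨γ, m, hm, by linear_combination h⟩
  · left
    obtain ⟨s, t, hs, ht, hst⟩ := exists_linear_factors (hφh 2 _ hQ) hφQ hi
    obtain ⟨m, hm, h⟩ := exists_linear_of_dvd hl hl0 (hQ.sub (hφh 2 _ hQ)) (hφd Q)
    exact ⟨s, hs, m, t, hm, ht, by rw [← hst]; linear_combination h⟩

/-- A pencil of quadrics with a reducible member `l * l'`. -/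
lemma span_or_square_or_commonIdeal_of_mul {Q l l' R : MvPolynomial (Fin n) ℂ}
    (hQ : Q.IsHomogeneous 2) (hQi : Irreducible Q)
    (hl : l.IsHomogeneous 1) (hl0 : l ≠ 0) (hl' : l'.IsHomogeneous 1) (hl0' : l' ≠ 0)
    (hR : R.IsHomogeneous 2)
    (hV : ∀ a, eval a Q = 0 → eval a (l * l') = 0 → eval a R = 0) :
    (∃ α β : ℂ, R = C α * Q + C β * (l * l')) ∨
      (∃ x : MvPolynomial (Fin n) ℂ, x.IsHomogeneous 1 ∧ l * l' = x ^ 2) ∨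
      CommonIdeal Q (l * l') := by
  rcases inIdeal_or_eq_of_vanish_on_hyperplane hQ hQi hl hl0 hR
    (fun a h1 h2 => hV a h1 (by rw [map_mul, h2, zero_mul])) with ⟨s, hs, h⟩ | ⟨γ, m, hm, h⟩
  · exact Or.inr (Or.inr ⟨l, s, hl, hs, h, l', 0, hl', isHomogeneous_zero _ _ _, by ring⟩)
  rcases inIdeal_or_eq_of_vanish_on_hyperplane hQ hQi hl' hl0' hR
    (fun a h1 h2 => hV a h1 (by rw [map_mul, h2, mul_zero])) with ⟨s, hs, h'⟩ | ⟨γ', m', hm', h'⟩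
  · exact Or.inr (Or.inr ⟨l', s, hl', hs, h', l, 0, hl, isHomogeneous_zero _ _ _, by ring⟩)
  by_cases hγ : γ = γ'
  · subst hγ
    have e : l * m = l' * m' := by linear_combination h' - h
    have : l ∣ l' * m' := ⟨m, e.symm⟩
    rcases (irreducible_linear hl hl0).prime.dvd_or_dvd this with d | d
    · right; left
      obtain ⟨c, hc⟩ := exists_C_of_dvd hl hl0 hl' d
      obtain ⟨r, hr⟩ := IsAlgClosed.exists_pow_nat_eq c (n := 2) (by norm_num)
      refine ⟨C r * l, hl.C_mul _, ?_⟩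
      rw [mul_pow, ← map_pow, hr, hc]; ring
    · left
      obtain ⟨c, hc⟩ := exists_C_of_dvd hl hl0 hm' d
      exact ⟨γ, c, by rw [h', hc]; ring⟩
  · right; right
    have hne : γ - γ' ≠ 0 := sub_ne_zero.2 hγ
    refine ⟨l, l', hl, hl', ⟨C (γ - γ')⁻¹ * (-m), C (γ - γ')⁻¹ * m', hm.neg.C_mul _,
      hm'.C_mul _, ?_⟩, l', 0, hl', isHomogeneous_zero _ _ _, by ring⟩
    have hC : (C (γ - γ')⁻¹ : MvPolynomial (Fin n) ℂ) * (C γ - C γ') = 1 := by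
      rw [← map_sub, ← map_mul, inv_mul_cancel₀ hne, map_one]
    linear_combination (-Q) * hC + C (γ - γ')⁻¹ * (h' - h)

lemma linear_induction {M : MvPolynomial (Fin n) ℂ → Prop} (h0 : M 0)
    (hadd : ∀ P Q, M P → M Q → M (P + Q)) (hC : ∀ c P, M P → M (C c * P)) (hX : ∀ i, M (X i))
    {l : MvPolynomial (Fin n) ℂ} (hl : l.IsHomogeneous 1) : M l := by
  replace hl : l ∈ homogeneousSubmodule (Fin n) ℂ 1 := hl
  rw [homogeneousSubmodule_one_eq_span_X] at hl
  induction hl using Submodule.span_induction with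
  | mem x h => obtain ⟨i, rfl⟩ := h; exact hX i
  | zero => exact h0
  | add x y _ _ hx hy => exact hadd x y hx hy
  | smul c x _ hx => rw [smul_eq_C_mul]; exact hC c x hx

lemma eval_smul_linear {l : MvPolynomial (Fin n) ℂ} (hl : l.IsHomogeneous 1) (t : ℂ)
    (e : Fin n → ℂ) : eval (t • e) l = t * eval e l := by
  have h0 := lin_eval hl 0 0 1
  have h1 := lin_eval hl 0 e t
  simp only [smul_zero, add_zero, zero_add, one_mul] at h0 h1
  linear_combination h1 - h0

/-- A linear form vanishing on the common zeros of a space of linear forms belongs to it. -/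
lemma mem_of_vanish {V : Submodule ℂ (MvPolynomial (Fin n) ℂ)}
    (hV : V ≤ homogeneousSubmodule (Fin n) ℂ 1) {l : MvPolynomial (Fin n) ℂ}
    (hl : l.IsHomogeneous 1)
    (h : ∀ e : Fin n → ℂ, (∀ v ∈ V, eval e v = 0) → eval e l = 0) : l ∈ V := by
  by_contra hn
  obtain ⟨f, hf, hker⟩ := Submodule.exists_le_ker_of_notMem hn
  have key : ∀ v : MvPolynomial (Fin n) ℂ, v.IsHomogeneous 1 → eval (fun i => f (X i)) v = f v := by
    intro v hv
    refine linear_induction (M := fun v => eval (fun i => f (X i)) v = f v) ?_ ?_ ?_ ?_ hv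
    · simp
    · intro P Q hP hQ; simp [hP, hQ]
    · intro c P hP; rw [map_mul, hP, eval_C, ← smul_eq_C_mul, map_smul, smul_eq_mul]
    · simp
  apply hf
  rw [← key l hl]
  exact h _ fun v hv => by rw [key v (hV hv)]; exact hker hv

lemma dirDeriv_eq_zero_of_mem_mul {V : Submodule ℂ (MvPolynomial (Fin n) ℂ)}
    (hV : V ≤ homogeneousSubmodule (Fin n) ℂ 1) {P : MvPolynomial (Fin n) ℂ} (hP : P ∈ V * V)
    {e : Fin n → ℂ} (he : ∀ v ∈ V, eval e v = 0) : dirDeriv P e = 0 := by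
  refine Submodule.mul_induction_on hP (fun l hl m hm => ?_) fun P Q hP hQ => ?_
  · rw [dirDeriv_linear_mul (hV hl) (hV hm), he l hl, he m hm]; simp
  · rw [dirDeriv_add, hP, hQ, add_zero]

lemma isHomogeneous_of_mem_mul {V : Submodule ℂ (MvPolynomial (Fin n) ℂ)}
    (hV : V ≤ homogeneousSubmodule (Fin n) ℂ 1) {P : MvPolynomial (Fin n) ℂ} (hP : P ∈ V * V) :
    P.IsHomogeneous 2 := by
  exact Submodule.mul_induction_on hP (fun l hl m hm => IsHomogeneous.mul (hV hl) (hV hm))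
    fun P Q hP hQ => hP.add hQ

/-- A quadratic invariant under all translations that `V` ignores is a quadratic over `V`. -/
lemma mem_mul_of_dirDeriv_eq_zero {V : Submodule ℂ (MvPolynomial (Fin n) ℂ)}
    (hV : V ≤ homogeneousSubmodule (Fin n) ℂ 1) {P : MvPolynomial (Fin n) ℂ}
    (hP : P.IsHomogeneous 2)
    (h : ∀ e : Fin n → ℂ, (∀ v ∈ V, eval e v = 0) → dirDeriv P e = 0) : P ∈ V * V := by
  obtain ⟨W, hW⟩ : ∃ W : Submodule ℂ (Fin n → ℂ), ∀ e, e ∈ W ↔ ∀ v ∈ V, eval e v = 0 := by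
    refine ⟨⨅ v ∈ V, LinearMap.ker (dirDeriv v), fun e => ?_⟩
    simp only [Submodule.mem_iInf, LinearMap.mem_ker]
    refine forall₂_congr fun v hv => ?_
    rw [dirDeriv_linear (hV hv)]; simp
  obtain ⟨W', hW'⟩ := W.exists_isCompl
  obtain ⟨p, hp1, hp2⟩ : ∃ p : (Fin n → ℂ) →ₗ[ℂ] (Fin n → ℂ), (∀ a, p a ∈ W) ∧
      ∀ a ∈ W, p a = a :=
    ⟨W.subtype ∘ₗ W.projectionOnto W' hW', fun a => Subtype.property _, fun a ha => by
      have := Submodule.projectionOnto_apply_left hW' ⟨a, ha⟩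
      simpa using congrArg Subtype.val this⟩
  obtain ⟨ℓ, hℓ, hℓe⟩ : ∃ ℓ : Fin n → MvPolynomial (Fin n) ℂ, (∀ i, (ℓ i).IsHomogeneous 1) ∧
      ∀ a i, eval a (ℓ i) = a i - p a i := by
    refine ⟨fun i => X i - ∑ j, C (p (Pi.single j 1) i) * X j, fun i => ?_, fun a i => ?_⟩
    · exact (isHomogeneous_X _ i).sub
        (IsHomogeneous.sum _ _ _ fun j _ => (isHomogeneous_X _ j).C_mul _)
    · rw [LinearMap.pi_apply_eq_sum_univ p a]
      have : ∀ j : Fin n, (fun k => if j = k then (1 : ℂ) else 0) = Pi.single j 1 := by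
        intro j; ext k; simp [Pi.single_apply, eq_comm]
      simp [this, mul_comm]
  have hℓV : ∀ i, ℓ i ∈ V := fun i => mem_of_vanish hV (hℓ i) fun e he => by
    rw [hℓe, hp2 e ((hW e).2 he), sub_self]
  have hlin : ∀ l : MvPolynomial (Fin n) ℂ, l.IsHomogeneous 1 → aeval ℓ l ∈ V := by
    intro l hl
    refine linear_induction (M := fun l => aeval ℓ l ∈ V) ?_ ?_ ?_ ?_ hl
    · simp
    · intro P Q hP hQ; rw [map_add]; exact V.add_mem hP hQ
    · intro c P hP
      rw [← smul_eq_C_mul, map_smul]; exact V.smul_mem _ hP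
    · intro i; simpa using hℓV i
  have hmem : aeval ℓ P ∈ V * V := by
    refine quad_induction (M := fun P => aeval ℓ P ∈ V * V) ?_ ?_ hP
    · intro P Q hP hQ; rw [map_add]; exact (V * V).add_mem hP hQ
    · intro l m hl hm; rw [map_mul]; exact Submodule.mul_mem_mul (hlin l hl) (hlin m hm)
  convert hmem
  apply MvPolynomial.funext
  intro a
  have h1 : eval a (aeval ℓ P) = eval (a + (-1 : ℂ) • p a) P := by
    rw [← aeval_eq_eval, ← aeval_eq_eval, ← AlgHom.comp_apply, comp_aeval]
    congr 2
    ext i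
    simp [aeval_eq_eval, hℓe]; ring
  have h2 := h _ ((hW (p a)).1 (hp1 a))
  have h3 := eval_dirDeriv_self hP (p a)
  rw [h2, map_zero] at h3
  rw [h1, quad_eval hP, h2, map_zero]
  linear_combination h3 / 2

lemma mem_of_mul_mem {V : Submodule ℂ (MvPolynomial (Fin n) ℂ)}
    (hV : V ≤ homogeneousSubmodule (Fin n) ℂ 1) {l m : MvPolynomial (Fin n) ℂ}
    (hl : l.IsHomogeneous 1) (hm : m.IsHomogeneous 1) (h : l * m ∈ V * V) (h0 : m ≠ 0) :
    l ∈ V := by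
  refine mem_of_vanish hV hl fun e he => ?_
  by_contra hle
  have h1 := dirDeriv_eq_zero_of_mem_mul hV h he
  have h2 := eval_dirDeriv_self (hl.mul hm) e
  rw [h1, map_zero, map_mul] at h2
  have hme : eval e m = 0 := by
    rcases mul_eq_zero.1 (show eval e l * eval e m = 0 by linear_combination - h2 / 2) with h | h
    exacts [absurd h hle, h]
  rw [dirDeriv_linear_mul hl hm, hme, C_0, zero_mul, zero_add] at h1
  rcases mul_eq_zero.1 h1 with h | h
  exacts [hle (C_eq_zero.1 h), h0 h]

lemma C_mul_mem {V : Submodule ℂ (MvPolynomial (Fin n) ℂ)} (c : ℂ) {P : MvPolynomial (Fin n) ℂ}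
    (h : P ∈ V) : C c * P ∈ V := by
  rw [← smul_eq_C_mul]; exact V.smul_mem c h

/-- A pencil of quadratics has a common singular direction for one of its members. -/
lemma exists_eigen_direction {P Q : MvPolynomial (Fin n) ℂ} (hP : P.IsHomogeneous 2)
    (hQ : Q.IsHomogeneous 2) (hP0 : P ≠ 0) :
    ∃ (e : Fin n → ℂ) (c : ℂ), (dirDeriv Q e = C c * dirDeriv P e ∧ dirDeriv P e ≠ 0) ∨
      (dirDeriv P e = C c * dirDeriv Q e ∧ dirDeriv Q e ≠ 0) := by
  by_cases hk : ∃ e, dirDeriv P e = 0 ∧ dirDeriv Q e ≠ 0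
  · obtain ⟨e, h1, h2⟩ := hk
    exact ⟨e, 0, Or.inr ⟨by rw [h1]; simp, h2⟩⟩
  push Not at hk
  have hr : ∀ b, dirDeriv Q b ∈ LinearMap.range (dirDeriv P) := by
    intro b
    refine mem_of_vanish ?_ (dirDeriv_isHomogeneous hQ b) fun e he => ?_
    · rintro _ ⟨a, rfl⟩; exact dirDeriv_isHomogeneous hP a
    · rw [eval_dirDeriv_comm hQ, hk e, map_zero]
      apply MvPolynomial.funext
      intro a
      rw [eval_dirDeriv_comm hP, he _ ⟨a, rfl⟩, map_zero]
  obtain ⟨g, hg⟩ := (dirDeriv P).rangeRestrict.exists_rightInverse_of_surjective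
    (LinearMap.range_rangeRestrict _)
  have hnt : Nontrivial (LinearMap.range (dirDeriv P)) := by
    rw [Submodule.nontrivial_iff_ne_bot]
    intro h
    rw [LinearMap.range_eq_bot] at h
    apply hP0
    apply MvPolynomial.funext
    intro a
    have := eval_dirDeriv_self hP a
    rw [h] at this
    simpa using this.symm
  obtain ⟨c, hc⟩ := Module.End.exists_eigenvalue
    (((dirDeriv Q) ∘ₗ g).codRestrict (LinearMap.range (dirDeriv P)) fun b => hr (g b))
  obtain ⟨v, hv⟩ := hc.exists_hasEigenvector
  have h1 : dirDeriv P (g v) = v := congrArg Subtype.val (LinearMap.congr_fun hg v)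
  refine ⟨g v, c, Or.inl ⟨?_, ?_⟩⟩
  · have := congrArg Subtype.val hv.apply_eq_smul
    rw [h1, ← smul_eq_C_mul]
    exact this
  · rw [h1]
    simpa using hv.2

lemma span_or_square_or_commonIdeal_of_eigen {P Q R : MvPolynomial (Fin n) ℂ} (hP : P.IsHomogeneous 2)
    (hQ : Q.IsHomogeneous 2) (hR : R.IsHomogeneous 2) (hPi : Irreducible P) (hQi : Irreducible Q)
    (hne : ∀ c, Q ≠ C c * P)
    (hV : ∀ a, eval a P = 0 → eval a Q = 0 → eval a R = 0) {e : Fin n → ℂ} {c : ℂ}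
    (h1 : dirDeriv Q e = C c * dirDeriv P e) (h2 : dirDeriv P e ≠ 0) :
    (∃ α β : ℂ, R = C α * P + C β * Q) ∨
      (∃ (α : ℂ) (x : MvPolynomial (Fin n) ℂ), α ≠ 0 ∧ x.IsHomogeneous 1 ∧ Q = C α * P + x ^ 2) ∨
      CommonIdeal P Q := by
  obtain ⟨A, hA⟩ : ∃ A, A = Q - C c * P := ⟨_, rfl⟩
  have hQA : Q = A + C c * P := by rw [hA]; ring
  have hAh : A.IsHomogeneous 2 := by rw [hA]; exact hQ.sub (hP.C_mul c)
  have hA0 : A ≠ 0 := fun h => hne c (by rw [hQA, h, zero_add])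
  have hAe : dirDeriv A e = 0 := by rw [hA, dirDeriv_sub, dirDeriv_C_mul, h1, sub_self]
  have hVA : ∀ a, eval a P = 0 → eval a A = 0 → eval a R = 0 := fun a ha hb =>
    hV a ha (by rw [hQA, map_add, map_mul, hb, ha]; ring)
  have inv : ∀ γ : ℂ, γ ≠ 0 → (C γ⁻¹ : MvPolynomial (Fin n) ℂ) * C γ = 1 := fun γ h => by
    rw [← map_mul, inv_mul_cancel₀ h, map_one]
  have hsq : ∀ (x : MvPolynomial (Fin n) ℂ), x.IsHomogeneous 1 → ¬ Irreducible (x ^ 2) :=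
    fun x hx => by rw [pow_two]; exact not_irreducible_mul hx hx
  have sq_smul : ∀ (γ : ℂ) (x : MvPolynomial (Fin n) ℂ), x.IsHomogeneous 1 →
      ∃ y : MvPolynomial (Fin n) ℂ, y.IsHomogeneous 1 ∧ C γ * x ^ 2 = y ^ 2 := by
    intro γ x hx
    obtain ⟨r, hr⟩ := IsAlgClosed.exists_pow_nat_eq γ (n := 2) (by norm_num)
    exact ⟨C r * x, hx.C_mul _, by rw [mul_pow, ← map_pow, hr]⟩
  -- members of the pencil that are reducible
  have hred : ∀ (s t : MvPolynomial (Fin n) ℂ) (κ μ : ℂ), μ ≠ 0 → s.IsHomogeneous 1 →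
      t.IsHomogeneous 1 → s * t ≠ 0 → s * t = C κ * P + C μ * Q →
      (∃ α β : ℂ, R = C α * P + C β * Q) ∨
      (∃ (α : ℂ) (x : MvPolynomial (Fin n) ℂ), α ≠ 0 ∧ x.IsHomogeneous 1 ∧ Q = C α * P + x ^ 2) ∨
      CommonIdeal P Q := by
    intro s t κ μ hμ hs ht hst h
    have hQst : Q = C (-(μ⁻¹ * κ)) * P + C μ⁻¹ * (s * t) := by
      rw [h, map_neg, map_mul]
      linear_combination (-Q) * inv μ hμ
    rcases span_or_square_or_commonIdeal_of_mul hP hPi hs (left_ne_zero_of_mul hst) ht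
      (right_ne_zero_of_mul hst) hR (fun a ha hb => hV a ha
        (by rw [hQst, map_add, map_mul, map_mul, ha, hb]; ring))
      with ⟨α, β, h'⟩ | ⟨x, hx, h'⟩ | ⟨a, b, ha, hb, h', h''⟩
    · exact Or.inl ⟨α + β * κ, β * μ, by rw [h', h]; simp only [map_add, map_mul]; ring⟩
    · right; left
      obtain ⟨y, hy, hxy⟩ := sq_smul μ⁻¹ x hx
      rw [h', hxy] at hQst
      refine ⟨_, y, fun h0 => ?_, hy, hQst⟩
      rw [h0, C_0, zero_mul, zero_add] at hQst
      exact hsq y hy (hQst ▸ hQi)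
    · right; right
      exact ⟨a, b, ha, hb, h', by rw [hQst]; exact h'.add_C_mul h'' _ _⟩
  by_cases hAi : Irreducible A
  · by_cases hPe : eval e P = 0
    · rcases span_or_reducible_or_ideal hAh hP hR hAi (fun a ha hb => hVA a hb ha) hAe hPe h2
        with ⟨α, β, h⟩ | ⟨κ, y, hy, h⟩ | ⟨M, k, h', z, hM, hk, hh, hz, hA', hP', -⟩
      · exact Or.inl ⟨β - α * c, α, by rw [h, hA]; simp only [map_sub, map_mul]; ring⟩
      · have hκ : κ ≠ 0 := by
          rintro rfl
          rw [C_0, zero_mul, zero_add] at h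
          exact not_irreducible_mul (dirDeriv_isHomogeneous hP e) hy (h ▸ hPi)
        refine hred _ y (1 + κ * c) (-κ) (by simpa using hκ) (dirDeriv_isHomogeneous hP e) hy ?_ ?_
        · intro h0
          rw [h0, add_zero] at h
          refine hne (κ⁻¹ + c) ?_
          rw [map_add]
          linear_combination hQA + (-A) * inv κ hκ - C κ⁻¹ * h
        · rw [hA] at h
          simp only [map_add, map_mul, map_neg, map_one]
          linear_combination - h
      · right; right
        refine ⟨dirDeriv P e, M, dirDeriv_isHomogeneous hP e, hM, ?_, ?_⟩
        · exact ⟨h', -k, hh, hk.neg, by linear_combination hP'⟩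
        · have i1 : InIdeal (dirDeriv P e) M A :=
            ⟨z, dirDeriv R e, hz, dirDeriv_isHomogeneous hR e, by linear_combination hA'⟩
          have i2 : InIdeal (dirDeriv P e) M P := ⟨h', -k, hh, hk.neg, by linear_combination hP'⟩
          rw [hQA]
          have := i1.add_C_mul i2 1 c
          rwa [C_1, one_mul] at this
    · rcases span_or_square_of_eval_ne_zero hAh hP hR hAi (fun a ha hb => hVA a hb ha) hAe hPe
        with ⟨α, β, h⟩ | ⟨γ, x, hx, h⟩
      · exact Or.inl ⟨β - α * c, α, by rw [h, hA]; simp only [map_sub, map_mul]; ring⟩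
      · have hγ : γ ≠ 0 := by
          rintro rfl
          rw [C_0, zero_mul, zero_add] at h
          exact hsq x hx (h ▸ hPi)
        by_cases hx0 : x = 0
        · exfalso
          rw [hx0, zero_pow two_ne_zero, add_zero] at h
          refine hne (γ⁻¹ + c) ?_
          rw [map_add]
          linear_combination hQA + (-A) * inv γ hγ - C γ⁻¹ * h
        · refine hred x x (1 + γ * c) (-γ) (by simpa using hγ) hx hx (mul_ne_zero hx0 hx0) ?_
          rw [hA] at h
          simp only [map_add, map_mul, map_neg, map_one]
          linear_combination - h
  · obtain ⟨s, t, hs, ht, hst⟩ := exists_linear_factors hAh hA0 hAi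
    refine hred s t (-c) 1 one_ne_zero hs ht (hst ▸ hA0) ?_
    rw [← hst, hA, map_neg, map_one]; ring

/-- Two irreducible quadratics and a third one vanishing on their common zeros. -/
theorem span_or_square_or_commonIdeal {P Q R : MvPolynomial (Fin n) ℂ} (hP : P.IsHomogeneous 2)
    (hQ : Q.IsHomogeneous 2) (hR : R.IsHomogeneous 2) (hPi : Irreducible P) (hQi : Irreducible Q)
    (hne : ∀ c, Q ≠ C c * P)
    (hV : ∀ a, eval a P = 0 → eval a Q = 0 → eval a R = 0) :
    (∃ α β : ℂ, R = C α * P + C β * Q) ∨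
      (∃ (α : ℂ) (x : MvPolynomial (Fin n) ℂ), α ≠ 0 ∧ x.IsHomogeneous 1 ∧ Q = C α * P + x ^ 2) ∨
      CommonIdeal P Q := by
  have inv : ∀ γ : ℂ, γ ≠ 0 → (C γ⁻¹ : MvPolynomial (Fin n) ℂ) * C γ = 1 := fun γ h => by
    rw [← map_mul, inv_mul_cancel₀ h, map_one]
  obtain ⟨e, c, ⟨h1, h2⟩ | ⟨h1, h2⟩⟩ := exists_eigen_direction hP hQ hPi.ne_zero
  · exact span_or_square_or_commonIdeal_of_eigen hP hQ hR hPi hQi hne hV h1 h2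
  · have hne' : ∀ c, P ≠ C c * Q := by
      rintro c rfl
      have hc : c ≠ 0 := by
        rintro rfl
        exact hPi.ne_zero (by simp)
      exact hne c⁻¹ (by linear_combination (-Q) * inv c hc)
    rcases span_or_square_or_commonIdeal_of_eigen hQ hP hR hQi hPi hne' (fun a ha hb => hV a hb ha) h1 h2
      with ⟨α, β, h⟩ | ⟨α, x, hα, hx, h⟩ | h
    · exact Or.inl ⟨β, α, by rw [h]; ring⟩
    · right; left
      obtain ⟨r, hr⟩ := IsAlgClosed.exists_pow_nat_eq (-α⁻¹) (n := 2) (by norm_num)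
      refine ⟨α⁻¹, C r * x, inv_ne_zero hα, hx.C_mul _, ?_⟩
      rw [mul_pow, ← map_pow, hr, map_neg]
      linear_combination (-Q) * inv α hα - C α⁻¹ * h
    · exact Or.inr (Or.inr h.symm)

/-- The exceptional configuration of a quadratic `A` over `V` with two quadratics `P` and `R`
that are not. -/
def SpecialTriple (V : Submodule ℂ (MvPolynomial (Fin n) ℂ)) (A P R : MvPolynomial (Fin n) ℂ) :
    Prop :=
  ∃ (a z m y : MvPolynomial (Fin n) ℂ) (c β γ : ℂ), a ∈ V ∧ z ∈ V ∧ m ∈ V ∧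
    y.IsHomogeneous 1 ∧ y ∉ V ∧ a ≠ 0 ∧ ¬ a ∣ m ∧ c ≠ 0 ∧ β ≠ 0 ∧
    A = a * z + C c * m ^ 2 ∧ P = a * y + C β * A ∧ R = y * m + C γ * A

lemma exists_perp_eval_eq_one {V : Submodule ℂ (MvPolynomial (Fin n) ℂ)}
    (hV : V ≤ homogeneousSubmodule (Fin n) ℂ 1) {y : MvPolynomial (Fin n) ℂ}
    (hy : y.IsHomogeneous 1) (hyV : y ∉ V) :
    ∃ u : Fin n → ℂ, (∀ v ∈ V, eval u v = 0) ∧ eval u y = 1 := by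
  have : ∃ e : Fin n → ℂ, (∀ v ∈ V, eval e v = 0) ∧ eval e y ≠ 0 := by
    by_contra h
    push Not at h
    exact hyV (mem_of_vanish hV hy h)
  obtain ⟨e, he, hey⟩ := this
  refine ⟨(eval e y)⁻¹ • e, fun v hv => ?_, ?_⟩
  · rw [eval_smul_linear (hV hv), he v hv, mul_zero]
  · rw [eval_smul_linear hy, inv_mul_cancel₀ hey]

/-- The binary quadratic forms factor. -/
lemma not_irreducible_binary {l m : MvPolynomial (Fin n) ℂ} (hl : l.IsHomogeneous 1)
    (hm : m.IsHomogeneous 1) (s b c : ℂ) (hc : c ≠ 0) :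
    ¬ Irreducible (C s * l ^ 2 + C b * (l * m) + C c * m ^ 2) := by
  obtain ⟨D, hD⟩ := IsAlgClosed.exists_pow_nat_eq (b ^ 2 - 4 * c * s) (n := 2) (by norm_num)
  obtain ⟨r, hr⟩ : ∃ r, r = (-b + D) / (2 * c) := ⟨_, rfl⟩
  have hr2 : s = - (r * (b + r * c)) := by
    rw [hr]; field_simp; linear_combination hD
  have : C s * l ^ 2 + C b * (l * m) + C c * m ^ 2 =
      (m - C r * l) * (C c * m + C (b + r * c) * l) := by
    rw [hr2]; simp only [map_neg, map_mul, map_add]; ring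
  rw [this]
  exact not_irreducible_mul (hm.sub (hl.C_mul _)) ((hm.C_mul _).add (hl.C_mul _))

lemma span_or_special_of_eq {V : Submodule ℂ (MvPolynomial (Fin n) ℂ)}
    (hV : V ≤ homogeneousSubmodule (Fin n) ℂ 1) {A P R a y : MvPolynomial (Fin n) ℂ} {κ : ℂ}
    (hA : A ∈ V * V) (hAi : Irreducible A) (hPi : Irreducible P)
    (hPV : P ∉ V * V) (hR : R.IsHomogeneous 2)
    (hvan : ∀ p, eval p A = 0 → eval p P = 0 → eval p R = 0)
    (ha : a ∈ V) (ha0 : a ≠ 0) (hy : y.IsHomogeneous 1) (hPy : P = C κ * A + a * y) :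
    (∃ α β : ℂ, R = C α * A + C β * P) ∨ SpecialTriple V A P R := by
  have hAh := isHomogeneous_of_mem_mul hV hA
  have hah : a.IsHomogeneous 1 := hV ha
  have hκ : κ ≠ 0 := by
    rintro rfl
    rw [C_0, zero_mul, zero_add] at hPy
    exact not_irreducible_mul hah hy (hPy ▸ hPi)
  have hyV : y ∉ V := fun h => hPV (by
    rw [hPy]
    exact (V * V).add_mem (C_mul_mem _ hA) (Submodule.mul_mem_mul ha h))
  have hy0 : y ≠ 0 := fun h => hyV (h ▸ V.zero_mem)
  obtain ⟨u, hu, huy⟩ := exists_perp_eval_eq_one hV hy hyV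
  have hDA : dirDeriv A u = 0 := dirDeriv_eq_zero_of_mem_mul hV hA hu
  have huA : eval u A = 0 := by
    have := eval_dirDeriv_self hAh u
    rw [hDA, map_zero] at this
    linear_combination - this / 2
  have htr : ∀ (p : Fin n → ℂ) (t : ℂ), eval (p + t • u) A = eval p A := by
    intro p t; rw [quad_eval hAh, hDA, huA]; simp
  have hfix : projAlong y u A = A := by
    apply MvPolynomial.funext
    intro p
    rw [eval_projAlong, htr]
  rcases inIdeal_or_eq_of_vanish_on_hyperplane hAh hAi hy hy0 hR (fun p h1 h2 => hvan p h1
    (by rw [hPy, map_add, map_mul, map_mul, h1, h2]; ring)) with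
    ⟨s, hs, c, d, -, hd, hA'⟩ | ⟨γ, m, hm, hRm⟩
  · exfalso
    have h2 := hfix
    rw [hA', map_add, map_mul, map_mul, projAlong_self hy huy, zero_mul, zero_add, ← hA'] at h2
    rw [← h2] at hAi
    exact not_irreducible_mul (projAlong_isHomogeneous hy u hs) (projAlong_isHomogeneous hy u hd)
      hAi
  have hmv : ∀ p, eval p a = 0 → eval p A = 0 → eval p m = 0 := by
    intro p h1 h2
    have key : ∀ t : ℂ, (eval p y + t) * (eval p m + t * eval u m) = 0 := by
      intro t
      have := hvan (p + t • u) (by rw [htr, h2])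
        (by rw [hPy, map_add, map_mul, map_mul, htr, h2, lin_eval hah, h1, hu a ha]; ring)
      rw [hRm, map_add, map_mul, map_mul, htr, h2, lin_eval hy, lin_eval hm, huy] at this
      linear_combination this
    have k0 := key 0
    have k1 := key 1
    have k2 := key (-1)
    have hum : eval u m = 0 := by linear_combination (k1 + k2) / 2 - k0
    rw [hum] at k1 k2
    linear_combination (k1 - k2) / 2
  obtain ⟨φ, hφh, hφd, hφ0, hφe⟩ := exists_reduction hah ha0
  have hφA : φ A ≠ 0 := fun h => by
    obtain ⟨w, hw, hAw⟩ := exists_linear_of_dvd hah ha0 hAh ((hφ0 A).1 h)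
    exact not_irreducible_mul hah hw (hAw ▸ hAi)
  have hφv : ∀ p, eval p (φ A) = 0 → eval p (φ m) = 0 := by
    intro p hp
    obtain ⟨q, hq, hqf⟩ := hφe p
    rw [hqf] at hp ⊢
    exact hmv q hq hp
  have hspan : φ m = 0 → ∃ α β : ℂ, R = C α * A + C β * P := by
    intro h
    obtain ⟨μ, hμ⟩ := exists_C_of_dvd hah ha0 hm ((hφ0 m).1 h)
    refine ⟨γ - μ * κ, μ, ?_⟩
    rw [hRm, hPy, hμ, map_sub, map_mul]; ring
  by_cases hφm : φ m = 0
  · exact Or.inl (hspan hφm)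
  right
  have hφmh := hφh 1 _ hm
  have hφi : ¬ Irreducible (φ A) := fun hi =>
    not_dvd_linear (hφh 2 _ hAh) hφmh hφm (dvd_of_vanish hi hφv)
  obtain ⟨s, t, hs, ht, hst⟩ := exists_linear_factors (hφh 2 _ hAh) hφA hφi
  have hs0 : s ≠ 0 := left_ne_zero_of_mul (hst ▸ hφA)
  have ht0 : t ≠ 0 := right_ne_zero_of_mul (hst ▸ hφA)
  obtain ⟨c1, hc1⟩ := exists_C_of_dvd hs hs0 hφmh (dvd_of_vanish (irreducible_linear hs hs0)
    fun p hp => hφv p (by rw [hst, map_mul, hp, zero_mul]))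
  obtain ⟨c2, hc2⟩ := exists_C_of_dvd ht ht0 hφmh (dvd_of_vanish (irreducible_linear ht ht0)
    fun p hp => hφv p (by rw [hst, map_mul, hp, mul_zero]))
  have hc10 : c1 ≠ 0 := by rintro rfl; exact hφm (by rw [hc1]; simp)
  have hc20 : c2 ≠ 0 := by rintro rfl; exact hφm (by rw [hc2]; simp)
  have inv : ∀ γ : ℂ, γ ≠ 0 → (C γ⁻¹ : MvPolynomial (Fin n) ℂ) * C γ = 1 := fun γ h => by
    rw [← map_mul, inv_mul_cancel₀ h, map_one]
  have hφAm : φ A = C (c1⁻¹ * c2⁻¹) * φ m ^ 2 := by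
    have e1 : C c1⁻¹ * φ m = s := by rw [hc1, ← mul_assoc, inv c1 hc10, one_mul]
    have e2 : C c2⁻¹ * φ m = t := by rw [hc2, ← mul_assoc, inv c2 hc20, one_mul]
    rw [hst, ← e1, ← e2, map_mul]; ring
  set c := c1⁻¹ * c2⁻¹
  have hc : c ≠ 0 := mul_ne_zero (inv_ne_zero hc10) (inv_ne_zero hc20)
  have hdvd : a ∣ A - C c * m ^ 2 := by
    have : A - C c * m ^ 2 = (A - φ A) - C c * (m + φ m) * (m - φ m) := by rw [hφAm]; ring
    rw [this]
    exact dvd_sub (hφd A) ((hφd m).mul_left _)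
  obtain ⟨z, hz, hAz⟩ := exists_linear_of_dvd hah ha0 (hAh.sub ((hm.pow 2).C_mul c)) hdvd
  have hAz' : A = a * z + C c * m ^ 2 := by linear_combination hAz
  have ham : ¬ a ∣ m := fun h => hφm ((hφ0 m).2 h)
  have hzm : ∀ e : Fin n → ℂ, (∀ v ∈ V, eval e v = 0) → eval e z = 0 ∧ eval e m = 0 := by
    intro e he
    have h1 := dirDeriv_eq_zero_of_mem_mul hV hA he
    rw [hAz', dirDeriv_add, dirDeriv_C_mul, pow_two, dirDeriv_linear_mul hah hz,
      dirDeriv_linear_mul hm hm, he a ha, C_0, zero_mul, add_zero] at h1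
    have hme : eval e m = 0 := by
      by_contra hme
      have : a ∣ C (2 * c * eval e m) * m := ⟨- C (eval e z), by
        simp only [map_mul, map_ofNat]; linear_combination h1⟩
      rcases (irreducible_linear hah ha0).prime.dvd_or_dvd this with h | h
      · have := isUnit_of_dvd_unit h ((IsUnit.mk0 _
          (mul_ne_zero (mul_ne_zero two_ne_zero hc) hme)).map C)
        exact (irreducible_linear hah ha0).not_isUnit this
      · exact ham h
    rw [hme] at h1
    simp only [C_0, zero_mul, add_zero, mul_zero] at h1
    exact ⟨C_eq_zero.1 ((mul_eq_zero.1 h1).resolve_right ha0), hme⟩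
  exact ⟨a, z, m, y, c, κ, γ, ha, mem_of_vanish hV hz fun e he => (hzm e he).1,
    mem_of_vanish hV hm fun e he => (hzm e he).2, hy, hyV, ha0, ham, hc, hκ, hAz',
    by rw [hPy]; ring, by rw [hRm]; ring⟩

/-- A quadratic `A` over `V`, a quadratic `P` that is not over `V`, and a third one vanishing on
their common zeros. -/
theorem span_or_square_or_special {V : Submodule ℂ (MvPolynomial (Fin n) ℂ)}
    (hV : V ≤ homogeneousSubmodule (Fin n) ℂ 1) {A P R : MvPolynomial (Fin n) ℂ}
    (hA : A ∈ V * V) (hAi : Irreducible A) (hP : P.IsHomogeneous 2) (hPi : Irreducible P)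
    (hPV : P ∉ V * V) (hR : R.IsHomogeneous 2)
    (hvan : ∀ p, eval p A = 0 → eval p P = 0 → eval p R = 0) :
    (∃ α β : ℂ, R = C α * A + C β * P) ∨
      (∃ (γ : ℂ) (x : MvPolynomial (Fin n) ℂ), x.IsHomogeneous 1 ∧ P = C γ * A + x ^ 2) ∨
      SpecialTriple V A P R := by
  have hAh := isHomogeneous_of_mem_mul hV hA
  by_cases h0 : ∃ e : Fin n → ℂ, (∀ v ∈ V, eval e v = 0) ∧ eval e P ≠ 0
  · obtain ⟨e, he, hPe⟩ := h0
    rcases span_or_square_of_eval_ne_zero hAh hP hR hAi hvan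
      (dirDeriv_eq_zero_of_mem_mul hV hA he) hPe with h | h
    exacts [Or.inl h, Or.inr (Or.inl h)]
  push Not at h0
  obtain ⟨e, he, hne⟩ : ∃ e : Fin n → ℂ, (∀ v ∈ V, eval e v = 0) ∧ dirDeriv P e ≠ 0 := by
    by_contra h
    push Not at h
    exact hPV (mem_mul_of_dirDeriv_eq_zero hV hP h)
  have hPe := h0 e he
  have hDA := dirDeriv_eq_zero_of_mem_mul hV hA he
  have hL1 := dirDeriv_isHomogeneous hP e
  have hL1V : dirDeriv P e ∈ V := mem_of_vanish hV hL1 fun e' he' => by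
    have h1 := quad_eval hP e' e 1
    rw [h0 _ (fun v hv => by rw [lin_eval (hV hv), he' v hv, he v hv]; ring), h0 e' he', hPe] at h1
    linear_combination - h1
  suffices h : (∃ α β : ℂ, R = C α * A + C β * P) ∨
      ∃ (κ : ℂ) (y : MvPolynomial (Fin n) ℂ), y.IsHomogeneous 1 ∧
        P = C κ * A + dirDeriv P e * y by
    rcases h with h | ⟨κ, y, hy, h⟩
    · exact Or.inl h
    rcases span_or_special_of_eq hV hA hAi hPi hPV hR hvan hL1V hne hy h with h | h
    exacts [Or.inl h, Or.inr (Or.inr h)]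
  rcases span_or_reducible_or_ideal hAh hP hR hAi hvan hDA hPe hne with
    h | h | ⟨M, k, h, z, hM, hk, hh, hz, hA', hP', hR'⟩
  · exact Or.inl h
  · exact Or.inr h
  right
  have hL3 := dirDeriv_isHomogeneous hR e
  have hL1e : eval e (dirDeriv P e) = 0 := by rw [eval_dirDeriv_self hP, hPe, mul_zero]
  have hAe : eval e A = 0 := by
    have := eval_dirDeriv_self hAh e
    rw [hDA, map_zero] at this
    linear_combination - this / 2
  have hRe : eval e R = 0 := hvan e hAe hPe
  have hL3e : eval e (dirDeriv R e) = 0 := by rw [eval_dirDeriv_self hR, hRe, mul_zero]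
  have hRtr : ∀ a t, eval (a + t • e) R = eval a R + t * eval a (dirDeriv R e) := by
    intro a t; rw [quad_eval hR, hRe]; ring
  set L1 := dirDeriv P e
  set L3 := dirDeriv R e
  obtain ⟨φ, hφh, hφd, hφ0, hφe⟩ := exists_reduction hL1 hne
  have hφL1 : φ L1 = 0 := (hφ0 L1).2 dvd_rfl
  have hφA : φ A = φ L3 * φ M := by rw [hA']; simp only [map_add, map_mul, hφL1]; ring
  have hφA0 : φ A ≠ 0 := fun h => by
    obtain ⟨w, hw, hAw⟩ := exists_linear_of_dvd hL1 hne hAh ((hφ0 A).1 h)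
    exact not_irreducible_mul hL1 hw (hAw ▸ hAi)
  have hφL3 : φ L3 ≠ 0 := left_ne_zero_of_mul (hφA ▸ hφA0)
  have hφM : φ M ≠ 0 := right_ne_zero_of_mul (hφA ▸ hφA0)
  have hMe : eval e M = 0 := by
    rw [hA', dirDeriv_add, dirDeriv_linear_mul hL1 hz, dirDeriv_linear_mul hL3 hM, hL1e, hL3e] at hDA
    have := congrArg φ hDA
    simp only [map_add, map_mul, hφL1, zero_mul, mul_zero, zero_add, add_zero, map_zero] at this
    have h2 := (mul_eq_zero.1 this).resolve_right hφL3
    rw [algHom_C] at h2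
    exact C_eq_zero.1 h2
  have hRv : ∀ p, eval p L1 = 0 → eval p M = 0 → eval p L3 = 0 ∧ eval p z * eval p k = 0 := by
    intro p h1 h2
    have hv : ∀ t : ℂ, eval (p + t • e) R = 0 := by
      intro t
      have e1 : eval (p + t • e) L1 = 0 := by rw [lin_eval hL1, h1, hL1e]; ring
      have e2 : eval (p + t • e) M = 0 := by rw [lin_eval hM, h2, hMe]; ring
      apply hvan
      · rw [hA', map_add, map_mul, map_mul, e1, e2]; ring
      · rw [hP', map_sub, map_mul, map_mul, e1, e2]; ring
    have r0 := hv 0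
    have r1 := hv 1
    rw [hRtr] at r0 r1
    have h3 : eval p L3 = 0 := by linear_combination r1 - r0
    refine ⟨h3, ?_⟩
    rw [hR', map_add, map_mul, map_mul, h3] at r0
    linear_combination r0
  have hφMh := hφh 1 _ hM
  obtain ⟨ψ, -, -, hψ0, hψe⟩ := exists_reduction hφMh hφM
  have hpt : ∀ p : Fin n → ℂ, ∃ q : Fin n → ℂ, eval q L1 = 0 ∧ eval q M = 0 ∧
      ∀ f, eval p (ψ (φ f)) = eval q f := by
    intro p
    obtain ⟨q, hq, hqf⟩ := hψe p
    obtain ⟨q', hq', hqf'⟩ := hφe q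
    exact ⟨q', hq', by rw [← hqf', hq], fun f => by rw [hqf, hqf']⟩
  have hdL3 : φ M ∣ φ L3 := (hψ0 _).1 <| MvPolynomial.funext fun p => by
    obtain ⟨q, h1, h2, hq⟩ := hpt p
    rw [hq, (hRv q h1 h2).1, map_zero]
  obtain ⟨c, hc⟩ := exists_C_of_dvd hφMh hφM (hφh 1 _ hL3) hdL3
  have hc0 : c ≠ 0 := by rintro rfl; exact hφL3 (by rw [hc]; simp)
  have hzk : ψ (φ z) * ψ (φ k) = 0 := MvPolynomial.funext fun p => by
    obtain ⟨q, h1, h2, hq⟩ := hpt p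
    rw [map_mul, hq, hq, (hRv q h1 h2).2, map_zero]
  have inv : ∀ γ : ℂ, γ ≠ 0 → (C γ⁻¹ : MvPolynomial (Fin n) ℂ) * C γ = 1 := fun γ h => by
    rw [← map_mul, inv_mul_cancel₀ h, map_one]
  have lift : ∀ f, f.IsHomogeneous 1 → ∀ r, φ f = C r * φ M → ∃ s, f = C r * M + C s * L1 := by
    intro f hf r hr
    have : L1 ∣ f - C r * M := by
      have : f - C r * M = (f - φ f) - C r * (M - φ M) := by rw [hr]; ring
      rw [this]
      exact dvd_sub (hφd f) ((hφd M).mul_left _)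
    obtain ⟨s, hs⟩ := exists_C_of_dvd hL1 hne (hf.sub (hM.C_mul r)) this
    exact ⟨s, by linear_combination hs⟩
  rcases mul_eq_zero.1 hzk with h0 | h0
  · exfalso
    obtain ⟨r, hr⟩ := exists_C_of_dvd hφMh hφM (hφh 1 _ hz) ((hψ0 _).1 h0)
    obtain ⟨s, hs⟩ := lift z hz r hr
    obtain ⟨s', hs'⟩ := lift L3 hL3 c hc
    refine not_irreducible_binary hL1 hM s (r + s') c hc0 ?_
    have : C s * L1 ^ 2 + C (r + s') * (L1 * M) + C c * M ^ 2 = A := by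
      rw [hA', map_add]; linear_combination - L1 * hs - M * hs'
    rwa [this]
  · obtain ⟨r, hr⟩ := exists_C_of_dvd hφMh hφM (hφh 1 _ hk) ((hψ0 _).1 h0)
    have hφP : φ P = C (-(r * c⁻¹)) * φ A := by
      have : φ P = - (φ M * φ k) := by rw [hP']; simp only [map_sub, map_mul, hφL1]; ring
      rw [this, hr, hφA, hc, map_neg, map_mul]
      linear_combination (C r * φ M ^ 2) * inv c hc0
    have : L1 ∣ P - C (-(r * c⁻¹)) * A := by
      have : P - C (-(r * c⁻¹)) * A = (P - φ P) - C (-(r * c⁻¹)) * (A - φ A) := by rw [hφP]; ring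
      rw [this]
      exact dvd_sub (hφd P) ((hφd A).mul_left _)
    obtain ⟨y, hy, h⟩ := exists_linear_of_dvd hL1 hne (hP.sub (hAh.C_mul _)) this
    exact ⟨_, y, hy, by linear_combination h⟩

lemma C_inv_mul_C {c : ℂ} (hc : c ≠ 0) : (C c⁻¹ : MvPolynomial (Fin n) ℂ) * C c = 1 := by
  rw [← map_mul, inv_mul_cancel₀ hc, map_one]

lemma exists_sq_eq_C_mul_sq (c : ℂ) {x : MvPolynomial (Fin n) ℂ} (hx : x.IsHomogeneous 1) :
    ∃ y : MvPolynomial (Fin n) ℂ, y.IsHomogeneous 1 ∧ C c * x ^ 2 = y ^ 2 := by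
  obtain ⟨r, hr⟩ := IsAlgClosed.exists_pow_nat_eq c (n := 2) (by norm_num)
  exact ⟨C r * x, hx.C_mul _, by rw [mul_pow, ← map_pow, hr]⟩

lemma not_irreducible_sq {x : MvPolynomial (Fin n) ℂ} (hx : x.IsHomogeneous 1) :
    ¬ Irreducible (x ^ 2) := by
  rw [pow_two]; exact not_irreducible_mul hx hx

/-- If `x ^ 2 - y ^ 2` is a nonzero quadratic over `V` then `x` and `y` lie in `V`. -/
lemma mem_of_sq_sub_sq_mem {V : Submodule ℂ (MvPolynomial (Fin n) ℂ)}
    (hV : V ≤ homogeneousSubmodule (Fin n) ℂ 1) {x y : MvPolynomial (Fin n) ℂ}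
    (hx : x.IsHomogeneous 1) (hy : y.IsHomogeneous 1) (h : x ^ 2 - y ^ 2 ∈ V * V)
    (h0 : x ^ 2 - y ^ 2 ≠ 0) : x ∈ V := by
  have e : x ^ 2 - y ^ 2 = (x - y) * (x + y) := by ring
  rw [e] at h h0
  have h1 := mem_of_mul_mem hV (hx.sub hy) (hx.add hy) h (right_ne_zero_of_mul h0)
  have h2 := mem_of_mul_mem hV (hx.add hy) (hx.sub hy) (mul_comm (x - y) _ ▸ h) (left_ne_zero_of_mul h0)
  have h3 := C_mul_mem (1 / 2 : ℂ) (V.add_mem h1 h2)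
  have h4 : C (1 / 2 : ℂ) * (x - y + (x + y)) = x := by
    have : (C (1 / 2 : ℂ) : MvPolynomial (Fin n) ℂ) * C 2 = 1 := by
      rw [← map_mul]; norm_num
    have h2 : (C 2 : MvPolynomial (Fin n) ℂ) = 2 := map_ofNat C 2
    rw [h2] at this
    linear_combination x * this
  rwa [h4] at h3

/-- Translation invariance of the quadratics over `V` in a direction `u` ignored by `V`. -/
lemma eval_eq_zero_of_mem_mul {V : Submodule ℂ (MvPolynomial (Fin n) ℂ)}
    (hV : V ≤ homogeneousSubmodule (Fin n) ℂ 1) {P : MvPolynomial (Fin n) ℂ} (hP : P ∈ V * V)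
    {u : Fin n → ℂ} (hu : ∀ v ∈ V, eval u v = 0) : eval u P = 0 := by
  have := eval_dirDeriv_self (isHomogeneous_of_mem_mul hV hP) u
  rw [dirDeriv_eq_zero_of_mem_mul hV hP hu, map_zero] at this
  linear_combination - this / 2

lemma dirDeriv_mul_add {V : Submodule ℂ (MvPolynomial (Fin n) ℂ)}
    (hV : V ≤ homogeneousSubmodule (Fin n) ℂ 1) {A a y : MvPolynomial (Fin n) ℂ}
    (hA : A ∈ V * V) (ha : a ∈ V) (hy : y.IsHomogeneous 1) (β : ℂ)
    {u : Fin n → ℂ} (hu : ∀ v ∈ V, eval u v = 0) :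
    dirDeriv (a * y + C β * A) u = C (eval u y) * a := by
  rw [dirDeriv_add, dirDeriv_C_mul, dirDeriv_eq_zero_of_mem_mul hV hA hu,
    dirDeriv_linear_mul (hV ha) hy, hu a ha, C_0]
  ring

lemma mul_add_ne_add_sq {V : Submodule ℂ (MvPolynomial (Fin n) ℂ)}
    (hV : V ≤ homogeneousSubmodule (Fin n) ℂ 1) {A A' a y x : MvPolynomial (Fin n) ℂ}
    (hA : A ∈ V * V) (hA' : A' ∈ V * V) (ha : a ∈ V) (ha0 : a ≠ 0) (hy : y.IsHomogeneous 1)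
    (hyV : y ∉ V) (hx : x.IsHomogeneous 1) (β γ : ℂ) :
    a * y + C β * A ≠ C γ * A' + x ^ 2 := by
  intro h
  obtain ⟨u, hu, huy⟩ := exists_perp_eval_eq_one hV hy hyV
  have h1 := dirDeriv_mul_add hV hA ha hy β hu
  have h2 := congrArg (eval u) h
  simp only [map_add, map_mul, map_pow, eval_eq_zero_of_mem_mul hV hA hu,
    eval_eq_zero_of_mem_mul hV hA' hu, hu a ha] at h2
  have hux : eval u x = 0 := by
    apply pow_eq_zero_iff two_ne_zero |>.1
    linear_combination - h2
  rw [h, add_comm, pow_two, dirDeriv_add, dirDeriv_C_mul, dirDeriv_eq_zero_of_mem_mul hV hA' hu,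
    dirDeriv_linear_mul hx hx, hux, huy] at h1
  simp only [C_0, zero_mul, add_zero, mul_zero, C_1, one_mul] at h1
  exact ha0 h1.symm

lemma SpecialTriple.ne_add_sq {V : Submodule ℂ (MvPolynomial (Fin n) ℂ)}
    (hV : V ≤ homogeneousSubmodule (Fin n) ℂ 1) {A A' P R : MvPolynomial (Fin n) ℂ}
    (hA : A ∈ V * V) (hA' : A' ∈ V * V) (h : SpecialTriple V A P R)
    {x : MvPolynomial (Fin n) ℂ} (hx : x.IsHomogeneous 1) (γ : ℂ) :
    P ≠ C γ * A' + x ^ 2 ∧ R ≠ C γ * A' + x ^ 2 := by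
  obtain ⟨a, z, m, y, c, β, γ', ha, hz, hm, hy, hyV, ha0, ham, hc, hβ, -, rfl, rfl⟩ := h
  refine ⟨mul_add_ne_add_sq hV hA hA' ha ha0 hy hyV hx β γ, ?_⟩
  rw [mul_comm y m]
  exact mul_add_ne_add_sq hV hA hA' hm (fun h => ham (h ▸ dvd_zero a)) hy hyV hx γ' γ

lemma SpecialTriple.notMem {V : Submodule ℂ (MvPolynomial (Fin n) ℂ)}
    (hV : V ≤ homogeneousSubmodule (Fin n) ℂ 1) {A P R : MvPolynomial (Fin n) ℂ}
    (hA : A ∈ V * V) (h : SpecialTriple V A P R) : R ∉ V * V := by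
  intro hR
  exact (h.ne_add_sq hV hA hR (isHomogeneous_zero _ _ _) 1).2 (by simp)

/-- Linear forms occurring in two decompositions `a * z + c * m ^ 2` of an irreducible quadratic. -/
lemma dvd_or_dvd_of_decompositions {A a z m a' z' : MvPolynomial (Fin n) ℂ} {c c' : ℂ}
    (hAi : Irreducible A) (ha : a.IsHomogeneous 1) (hz : z.IsHomogeneous 1)
    (hm : m.IsHomogeneous 1) (ha' : a'.IsHomogeneous 1) (hz' : z'.IsHomogeneous 1)
    (h : A = a * z + C c * m ^ 2) (h' : A = a' * z' + C c' * m ^ 2) : a ∣ a' ∨ a ∣ z' := by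
  have hc : c ≠ 0 := by
    rintro rfl
    rw [C_0, zero_mul, add_zero] at h
    exact not_irreducible_mul ha hz (h ▸ hAi)
  have ha0 : a ≠ 0 := by
    rintro rfl
    obtain ⟨y, hy, hxy⟩ := exists_sq_eq_C_mul_sq c hm
    rw [zero_mul, zero_add, hxy] at h
    exact not_irreducible_sq hy (h ▸ hAi)
  have hm0 : m ≠ 0 := by
    rintro rfl
    rw [zero_pow two_ne_zero, mul_zero, add_zero] at h
    exact not_irreducible_mul ha hz (h ▸ hAi)
  have ham : ¬ a ∣ m := by
    intro hd
    obtain ⟨s, rfl⟩ := exists_C_of_dvd ha ha0 hm hd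
    refine not_irreducible_mul ha (hz.add ((ha.C_mul s).C_mul (c * s))) ?_
    rw [h] at hAi
    convert hAi using 1
    rw [map_mul]; ring
  have hma : ¬ m ∣ a := by
    intro hd
    obtain ⟨s, rfl⟩ := exists_C_of_dvd hm hm0 ha hd
    refine not_irreducible_mul hm ((hz.C_mul s).add (hm.C_mul c)) ?_
    rw [h] at hAi
    convert hAi using 1
    ring
  obtain ⟨φ, hφh, hφd, hφ0, -⟩ := exists_reduction hm hm0
  have hφa : φ a ≠ 0 := fun h => hma ((hφ0 a).1 h)
  have hφm : φ m = 0 := (hφ0 m).2 dvd_rfl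
  have key : ∀ p q : MvPolynomial (Fin n) ℂ, p.IsHomogeneous 1 → q.IsHomogeneous 1 →
      A = p * q + C c' * m ^ 2 → φ a ∣ φ p → a ∣ p := by
    intro p q hp hq hA hd
    obtain ⟨r, hr⟩ := exists_C_of_dvd (hφh 1 _ ha) hφa (hφh 1 _ hp) hd
    have : m ∣ p - C r * a := by
      have : p - C r * a = (p - φ p) - C r * (a - φ a) := by rw [hr]; ring
      rw [this]
      exact dvd_sub (hφd p) ((hφd a).mul_left _)
    obtain ⟨s, hs⟩ := exists_C_of_dvd hm hm0 (hp.sub (ha.C_mul r)) this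
    have hps : p = C r * a + C s * m := by linear_combination hs
    by_cases hs0 : s = 0
    · rw [hps, hs0]; simp
    exfalso
    have e1 : a ∣ m * (C s * q + C (c' - c) * m) := by
      refine ⟨z - C r * q, ?_⟩
      rw [hps] at hA
      rw [map_sub]
      linear_combination h - hA
    have e2 := ((irreducible_linear ha ha0).prime.dvd_or_dvd e1).resolve_left ham
    obtain ⟨g, hg⟩ := exists_C_of_dvd ha ha0 ((hq.C_mul s).add (hm.C_mul (c' - c))) e2
    have hq' : q = C s⁻¹ * (C g * a - C (c' - c) * m) := by
      linear_combination C s⁻¹ * hg - q * C_inv_mul_C hs0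
    have hz2 : z = C r * q + C g * m := by
      apply mul_left_cancel₀ ha0
      rw [hps] at hA
      rw [map_sub] at hg
      linear_combination hA - h + m * hg
    refine not_irreducible_binary ha hm (r * s⁻¹ * g) (g - r * s⁻¹ * (c' - c)) c hc ?_
    rw [h, hz2, hq'] at hAi
    convert hAi using 1
    simp only [map_sub, map_mul]; ring
  have hdvd : φ a ∣ φ a' * φ z' := by
    refine ⟨φ z, ?_⟩
    have := congrArg φ (h.symm.trans h')
    simp only [map_add, map_mul, map_pow, hφm] at this
    linear_combination - this
  rcases (irreducible_linear (hφh 1 _ ha) hφa).prime.dvd_or_dvd hdvd with hd | hd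
  · exact Or.inl (key a' z' ha' hz' h' hd)
  · exact Or.inr (key z' a' hz' ha' (by rw [h']; ring) hd)

lemma SpecialTriple.eq_of_eq {V : Submodule ℂ (MvPolynomial (Fin n) ℂ)}
    (hV : V ≤ homogeneousSubmodule (Fin n) ℂ 1) {A A' P R : MvPolynomial (Fin n) ℂ}
    (hA : A ∈ V * V) (hAi : Irreducible A) (hA' : A' ∈ V * V)
    (h : SpecialTriple V A P R) (h' : SpecialTriple V A' P R) :
    ∃ c, A = C c * A' := by
  obtain ⟨a, z, m, y, c, β, γ, ha, hz, hm, hy, hyV, ha0, ham, hc, hβ, -, hP, hR⟩ := h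
  obtain ⟨a', z', m', y', c', β', γ', ha', hz', hm', hy', hyV', ha0', ham', hc', hβ', -, hP', hR'⟩ :=
    h'
  obtain ⟨u, hu, huy⟩ := exists_perp_eval_eq_one hV hy hyV
  have e1 : a = C (eval u y') * a' := by
    have h1 := dirDeriv_mul_add hV hA ha hy β hu
    rw [← hP, hP', dirDeriv_mul_add hV hA' ha' hy' β' hu, huy, C_1, one_mul] at h1
    exact h1.symm
  have e2 : m = C (eval u y') * m' := by
    have h1 := dirDeriv_mul_add hV hA hm hy γ hu
    rw [mul_comm m y, ← hR, hR', mul_comm y' m', dirDeriv_mul_add hV hA' hm' hy' γ' hu, huy, C_1,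
      one_mul] at h1
    exact h1.symm
  set t := eval u y'
  obtain ⟨w, hw⟩ : ∃ w, w = C t * y - y' := ⟨_, rfl⟩
  have hwh : w.IsHomogeneous 1 := by rw [hw]; exact (hy.C_mul t).sub hy'
  have f1 : a' * w = C β' * A' - C β * A := by
    rw [hw]; rw [e1] at hP; linear_combination hP' - hP
  have f2 : m' * w = C γ' * A' - C γ * A := by
    rw [hw]; rw [e2] at hR; linear_combination hR' - hR
  have f3 : C (γ' * β - β' * γ) * A = w * (C β' * m' - C γ' * a') := by
    simp only [map_sub, map_mul]; linear_combination C γ' * f1 - C β' * f2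
  by_cases hd : γ' * β - β' * γ = 0
  · rw [hd, C_0, zero_mul] at f3
    rcases mul_eq_zero.1 f3.symm with h0 | h0
    · rw [h0, mul_zero] at f1
      exact ⟨β⁻¹ * β', by rw [map_mul]; linear_combination (-A) * C_inv_mul_C hβ + C β⁻¹ * f1⟩
    · exact absurd ⟨C β'⁻¹ * C γ', by
        linear_combination (-m') * C_inv_mul_C hβ' + C β'⁻¹ * h0⟩ ham'
  · exfalso
    refine not_irreducible_mul (hwh.C_mul (γ' * β - β' * γ)⁻¹)
      (((hV hm').C_mul β').sub ((hV ha').C_mul γ')) ?_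
    convert hAi using 1
    linear_combination A * C_inv_mul_C hd - C (γ' * β - β' * γ)⁻¹ * f3

/-- Three first members over one third member of a special triple. -/
lemma SpecialTriple.span_of_three {V : Submodule ℂ (MvPolynomial (Fin n) ℂ)}
    (hV : V ≤ homogeneousSubmodule (Fin n) ℂ 1) {A P P' P'' R : MvPolynomial (Fin n) ℂ}
    (hA : A ∈ V * V) (hAi : Irreducible A)
    (h : SpecialTriple V A P R) (h' : SpecialTriple V A P' R) (h'' : SpecialTriple V A P'' R) :
    (∃ α β, P' = C α * A + C β * P) ∨ (∃ α β, P'' = C α * A + C β * P) ∨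
      ∃ α β, P'' = C α * A + C β * P' := by
  obtain ⟨a, z, m, y, c, β, γ, ha, hz, hm, hy, hyV, ha0, ham, hc, hβ, hAz, hP, hR⟩ := h
  have hm0 : m ≠ 0 := fun h => ham (h ▸ dvd_zero a)
  obtain ⟨u, hu, huy⟩ := exists_perp_eval_eq_one hV hy hyV
  have key : ∀ P', SpecialTriple V A P' R → ∃ (a' z' : MvPolynomial (Fin n) ℂ) (c' β' : ℂ),
      a'.IsHomogeneous 1 ∧ z'.IsHomogeneous 1 ∧ A = a' * z' + C c' * m ^ 2 ∧
      P' = a' * y + C β' * A := by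
    rintro P' ⟨a', z', m', y', c', β', γ', ha', hz', hm', hy', hyV', ha0', ham', hc', hβ', hAz',
      hP', hR'⟩
    have e2 : m = C (eval u y') * m' := by
      have h1 := dirDeriv_mul_add hV hA hm hy γ hu
      rw [mul_comm m y, ← hR, hR', mul_comm y' m', dirDeriv_mul_add hV hA hm' hy' γ' hu, huy, C_1,
        one_mul] at h1
      exact h1.symm
    set t := eval u y'
    have ht : t ≠ 0 := by
      intro h
      rw [h, C_0, zero_mul] at e2
      exact hm0 e2
    have hm0' : m' ≠ 0 := by rintro rfl; exact ham' (dvd_zero _)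
    have f2 : m' * (C t * y - y') = C (γ' - γ) * A := by
      rw [e2] at hR; rw [map_sub]; linear_combination hR' - hR
    have hγ : γ' - γ = 0 := by
      by_contra hd
      refine not_irreducible_mul ((hV hm').C_mul (γ' - γ)⁻¹) ((hy.C_mul t).sub hy') ?_
      convert hAi using 1
      linear_combination A * C_inv_mul_C hd + C (γ' - γ)⁻¹ * f2
    rw [hγ, C_0, zero_mul] at f2
    have hyt := (mul_eq_zero.1 f2).resolve_left hm0'
    refine ⟨C t * a', C t⁻¹ * z', c' * t⁻¹ ^ 2, β', (hV ha').C_mul _, (hV hz').C_mul _, ?_, ?_⟩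
    · rw [hAz', e2, map_mul, map_pow]
      have := C_inv_mul_C (n := n) ht
      linear_combination (-(a' * z') - C c' * m' ^ 2 * (C t⁻¹ * C t + 1)) * this
    · rw [hP']; linear_combination - a' * hyt
  obtain ⟨a', z', c', β', ha', hz', hAz', hP'⟩ := key P' h'
  obtain ⟨a'', z'', c'', β'', ha'', hz'', hAz'', hP''⟩ := key P'' h''
  have hne : ∀ (a z : MvPolynomial (Fin n) ℂ) (c : ℂ), A = a * z + C c * m ^ 2 →
      a ≠ 0 ∧ z ≠ 0 := by
    intro a z c h
    rw [← mul_ne_zero_iff]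
    intro h0
    obtain ⟨y, hy, hxy⟩ := exists_sq_eq_C_mul_sq c (hV hm)
    rw [h0, zero_add, hxy] at h
    exact not_irreducible_sq hy (h ▸ hAi)
  have concl : ∀ (a a' P P' : MvPolynomial (Fin n) ℂ) (β β' : ℂ), a.IsHomogeneous 1 → a ≠ 0 →
      a'.IsHomogeneous 1 → P = a * y + C β * A → P' = a' * y + C β' * A → a ∣ a' →
      ∃ α β, P' = C α * A + C β * P := by
    intro a a' P P' β β' ha h0 ha' hP hP' hd
    obtain ⟨r, hr⟩ := exists_C_of_dvd ha h0 ha' hd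
    refine ⟨β' - r * β, r, ?_⟩
    rw [hP', hP, hr, map_sub, map_mul]; ring
  rcases dvd_or_dvd_of_decompositions hAi (hV ha) (hV hz) (hV hm) ha' hz' hAz hAz' with d1 | d1
  · exact Or.inl (concl a a' P P' β β' (hV ha) ha0 ha' hP hP' d1)
  rcases dvd_or_dvd_of_decompositions hAi (hV ha) (hV hz) (hV hm) ha'' hz'' hAz hAz'' with d2 | d2
  · exact Or.inr (Or.inl (concl a a'' P P'' β β'' (hV ha) ha0 ha'' hP hP'' d2))
  rcases dvd_or_dvd_of_decompositions hAi ha' hz' (hV hm) ha'' hz'' hAz' hAz'' with d3 | d3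
  · exact Or.inr (Or.inr (concl a' a'' P' P'' β' β'' ha' (hne _ _ _ hAz').1 ha'' hP' hP'' d3))
  left
  refine concl a a' P P' β β' (hV ha) ha0 ha' hP hP' ?_
  obtain ⟨r, hr⟩ := exists_C_of_dvd ha' (hne _ _ _ hAz').1 hz'' d3
  have hr0 : r ≠ 0 := by
    rintro rfl
    exact (hne _ _ _ hAz'').2 (by rw [hr]; simp)
  rw [hr] at d2
  have := d2.mul_left (C r⁻¹)
  rwa [← mul_assoc, C_inv_mul_C hr0, one_mul] at this

/-- The third member of a special triple is not the second member of another one. -/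
lemma SpecialTriple.not_special_third {V : Submodule ℂ (MvPolynomial (Fin n) ℂ)}
    (hV : V ≤ homogeneousSubmodule (Fin n) ℂ 1) {A P R R' : MvPolynomial (Fin n) ℂ}
    (hA : A ∈ V * V) (hAi : Irreducible A) (h : SpecialTriple V A P R) :
    ¬ SpecialTriple V A R R' := by
  rintro ⟨a', z', m', y', c', β', γ', ha', hz', hm', hy', hyV', ha0', ham', hc', hβ', hAz', hR', -⟩
  obtain ⟨a, z, m, y, c, β, γ, ha, hz, hm, hy, hyV, ha0, ham, hc, hβ, hAz, -, hR⟩ := h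
  have hm0 : m ≠ 0 := fun h => ham (h ▸ dvd_zero a)
  obtain ⟨u, hu, huy⟩ := exists_perp_eval_eq_one hV hy hyV
  have e2 : m = C (eval u y') * a' := by
    have h1 := dirDeriv_mul_add hV hA hm hy γ hu
    rw [mul_comm m y, ← hR, hR', dirDeriv_mul_add hV hA ha' hy' β' hu, huy, C_1, one_mul] at h1
    exact h1.symm
  set t := eval u y'
  have hma : ¬ m ∣ a := by
    intro hd
    obtain ⟨s, hs⟩ := exists_C_of_dvd (hV hm) hm0 (hV ha) hd
    refine not_irreducible_mul (hV hm) (((hV hz).C_mul s).add ((hV hm).C_mul c)) ?_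
    convert hAi using 1
    rw [hAz, hs]; ring
  obtain ⟨φ, hφh, hφd, hφ0, -⟩ := exists_reduction (hV hm) hm0
  have hφa : φ a ≠ 0 := fun h => hma ((hφ0 a).1 h)
  have hφm : φ m = 0 := (hφ0 m).2 dvd_rfl
  have ht : t ≠ 0 := fun h => hm0 (by rw [e2, h, C_0, zero_mul])
  have hφa' : φ a' = 0 := by
    rw [hφ0]
    refine ⟨C t⁻¹, ?_⟩
    rw [e2]; linear_combination (-a') * C_inv_mul_C ht
  have e3 : φ a * φ z = C c' * φ m' ^ 2 := by
    have := congrArg φ (hAz.symm.trans hAz')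
    simp only [map_add, map_mul, map_pow, hφm, hφa', algHom_C] at this
    simp only [algebraMap_eq] at this
    linear_combination this
  have hpr := (irreducible_linear (hφh 1 _ (hV ha)) hφa).prime
  have d1 : φ a ∣ φ m' ^ 2 :=
    ⟨C c'⁻¹ * φ z, by linear_combination (-φ m' ^ 2) * C_inv_mul_C hc' - C c'⁻¹ * e3⟩
  obtain ⟨r, hr⟩ := exists_C_of_dvd (hφh 1 _ (hV ha)) hφa (hφh 1 _ (hV hm')) (hpr.dvd_of_dvd_pow d1)
  have e4 : φ z = C (c' * r ^ 2) * φ a := by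
    apply mul_left_cancel₀ hφa
    rw [e3, hr, map_mul, map_pow]; ring
  have : m ∣ z - C (c' * r ^ 2) * a := by
    have : z - C (c' * r ^ 2) * a = (z - φ z) - C (c' * r ^ 2) * (a - φ a) := by rw [e4]; ring
    rw [this]
    exact dvd_sub (hφd z) ((hφd a).mul_left _)
  obtain ⟨s, hs⟩ := exists_C_of_dvd (hV hm) hm0 ((hV hz).sub ((hV ha).C_mul _)) this
  refine not_irreducible_binary (hV ha) (hV hm) (c' * r ^ 2) s c hc ?_
  convert hAi using 1
  rw [hAz]; linear_combination - a * hs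

/-- A Sylvester–Gallai configuration of irreducible quadratics `Q` and squares `L`. -/
structure Config (Q L : Finset (MvPolynomial (Fin n) ℂ)) : Prop where
  hom : ∀ P ∈ Q ∪ L, P.IsHomogeneous 2
  indep : ∀ P ∈ Q ∪ L, ∀ P' ∈ Q ∪ L, P ≠ P' → LinearIndependent ℂ ![P, P']
  third : ∀ P1 ∈ Q ∪ L, ∀ P2 ∈ Q ∪ L, P1 ≠ P2 → ∃ P3 ∈ Q ∪ L, P3 ≠ P1 ∧ P3 ≠ P2 ∧
    ∀ a : Fin n → ℂ, eval a P1 = 0 → eval a P2 = 0 → eval a P3 = 0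
  irred : ∀ P ∈ Q, Irreducible P
  sq : ∀ P ∈ L, ∃ ℓ : MvPolynomial (Fin n) ℂ, ℓ.IsHomogeneous 1 ∧ P = ℓ ^ 2

/-- `Q` contains a third member on the line spanned by `A` and `P`. -/
def HasThird (Q : Finset (MvPolynomial (Fin n) ℂ)) (A P : MvPolynomial (Fin n) ℂ) : Prop :=
  ∃ B ∈ Q, B ≠ A ∧ B ≠ P ∧ ∃ α β : ℂ, B = C α * A + C β * P

/-- The members of `Q` joined to `A` by a line containing a third member. -/
noncomputable def lineSet (Q : Finset (MvPolynomial (Fin n) ℂ)) (A : MvPolynomial (Fin n) ℂ) :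
    Finset (MvPolynomial (Fin n) ℂ) :=
  Q.filter fun P => P ≠ A ∧ HasThird Q A P

lemma card_lineSet_lt {Q : Finset (MvPolynomial (Fin n) ℂ)} {A : MvPolynomial (Fin n) ℂ}
    (h : IsBad Q A) : 100 * (lineSet Q A).card < Q.card := by
  have h1 : (lineSet Q A).card ≤
      ((Q ×ˢ Q).filter (fun AB => A ≠ AB.1 ∧ A ≠ AB.2 ∧ AB.1 ≠ AB.2 ∧
        AB.2 ∈ Submodule.span ℂ ({A, AB.1} : Set (MvPolynomial (Fin n) ℂ)))).card := by
    refine Finset.card_le_card_of_forall_subsingleton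
      (fun (P : MvPolynomial (Fin n) ℂ)
        (AB : MvPolynomial (Fin n) ℂ × MvPolynomial (Fin n) ℂ) => AB.1 = P)
      (fun P hP => ?_) (fun AB _ P hP P' hP' => hP.2.symm.trans hP'.2)
    obtain ⟨hPQ, hPA, B, hB, hBA, hBP, α, β, hspan⟩ := Finset.mem_filter.1 hP
    refine ⟨(P, B), ?_, rfl⟩
    rw [Finset.mem_filter, Finset.mem_product]
    refine ⟨⟨hPQ, hB⟩, hPA.symm, hBA.symm, hBP.symm, ?_⟩
    rw [Submodule.mem_span_pair]
    exact ⟨α, β, by rw [hspan, smul_eq_C_mul, smul_eq_C_mul]⟩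
  have h2 := lt_of_le_of_lt (Nat.cast_le.2 h1) h
  rw [lt_div_iff₀ (by norm_num)] at h2
  have : ((lineSet Q A).card * 100 : ℕ) < Q.card := by exact_mod_cast h2
  omega

namespace Config

variable {Q L : Finset (MvPolynomial (Fin n) ℂ)}

lemma homQ (h : Config Q L) {P : MvPolynomial (Fin n) ℂ} (hP : P ∈ Q) : P.IsHomogeneous 2 :=
  h.hom P (Finset.mem_union_left _ hP)

lemma indep_pair (h : Config Q L) {P P' : MvPolynomial (Fin n) ℂ} (hP : P ∈ Q ∪ L)
    (hP' : P' ∈ Q ∪ L) (hne : P ≠ P') {α β : ℂ} (h0 : C α * P + C β * P' = 0) :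
    α = 0 ∧ β = 0 :=
  LinearIndependent.pair_iff.1 (h.indep P hP P' hP' hne) α β
    (by rw [smul_eq_C_mul, smul_eq_C_mul, h0])

lemma eq_of_eq_C_mul (h : Config Q L) {P P' : MvPolynomial (Fin n) ℂ} (hP : P ∈ Q ∪ L)
    (hP' : P' ∈ Q ∪ L) {c : ℂ} (hc : P = C c * P') : P = P' := by
  by_contra hne
  have := (h.indep_pair hP hP' hne (α := 1) (β := -c)
    (by rw [C_1, map_neg]; linear_combination hc)).1
  exact one_ne_zero this

lemma eq_of_C_mul_eq (h : Config Q L) {P P' : MvPolynomial (Fin n) ℂ} (hP : P ∈ Q ∪ L)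
    (hP' : P' ∈ Q ∪ L) {c c' : ℂ} (hc : c ≠ 0) (hcc : C c * P = C c' * P') : P = P' := by
  by_contra hne
  exact hc (h.indep_pair hP hP' hne (α := c) (β := -c')
    (by rw [map_neg]; linear_combination hcc)).1

lemma coeff_ne_zero (h : Config Q L) {A P B : MvPolynomial (Fin n) ℂ} (hA : A ∈ Q) (hP : P ∈ Q)
    (hB : B ∈ Q ∪ L) (hBA : B ≠ A) (hBP : B ≠ P) {α β : ℂ} (hs : B = C α * A + C β * P) :
    α ≠ 0 ∧ β ≠ 0 := by
  constructor
  · rintro rfl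
    exact hBP (h.eq_of_eq_C_mul hB (Finset.mem_union_left _ hP) (c := β)
      (by rw [hs, C_0]; ring))
  · rintro rfl
    exact hBA (h.eq_of_eq_C_mul hB (Finset.mem_union_left _ hA) (c := α)
      (by rw [hs, C_0]; ring))

lemma hasThird_or_square_of_span (h : Config Q L) {A P B : MvPolynomial (Fin n) ℂ} (hA : A ∈ Q)
    (hP : P ∈ Q) (hB : B ∈ Q ∪ L) (hBA : B ≠ A) (hBP : B ≠ P) {α β : ℂ}
    (hs : B = C α * A + C β * P) :
    HasThird Q A P ∨ ∃ (γ : ℂ) (x : MvPolynomial (Fin n) ℂ), γ ≠ 0 ∧ x.IsHomogeneous 1 ∧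
      P = C γ * A + x ^ 2 := by
  rcases Finset.mem_union.1 hB with hB' | hB'
  · exact Or.inl ⟨B, hB', hBA, hBP, α, β, hs⟩
  · right
    obtain ⟨hα, hβ⟩ := h.coeff_ne_zero hA hP hB hBA hBP hs
    obtain ⟨ℓ, hℓ, rfl⟩ := h.sq B hB'
    obtain ⟨x, hx, hxl⟩ := exists_sq_eq_C_mul_sq β⁻¹ hℓ
    refine ⟨-(β⁻¹ * α), x, neg_ne_zero.2 (mul_ne_zero (inv_ne_zero hβ) hα), hx, ?_⟩
    rw [← hxl, hs, map_neg, map_mul]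
    linear_combination (-P) * C_inv_mul_C hβ

/-- The trichotomy for two irreducible members of a configuration. -/
lemma pair (h : Config Q L) {A P : MvPolynomial (Fin n) ℂ} (hA : A ∈ Q) (hP : P ∈ Q)
    (hne : A ≠ P) :
    HasThird Q A P ∨ (∃ (γ : ℂ) (x : MvPolynomial (Fin n) ℂ), γ ≠ 0 ∧ x.IsHomogeneous 1 ∧
      P = C γ * A + x ^ 2) ∨ CommonIdeal A P := by
  have hA' : A ∈ Q ∪ L := Finset.mem_union_left _ hA
  have hP' : P ∈ Q ∪ L := Finset.mem_union_left _ hP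
  obtain ⟨B, hB, hBA, hBP, hv⟩ := h.third A hA' P hP' hne
  rcases span_or_square_or_commonIdeal (h.homQ hA) (h.homQ hP) (h.hom B hB) (h.irred A hA)
    (h.irred P hP) (fun c hc => hne (h.eq_of_eq_C_mul hP' hA' hc).symm) hv with
    ⟨α, β, hs⟩ | hs | hs
  · rcases h.hasThird_or_square_of_span hA hP hB hBA hBP hs with h | h
    exacts [Or.inl h, Or.inr (Or.inl h)]
  · exact Or.inr (Or.inl hs)
  · exact Or.inr (Or.inr hs)

lemma pair_over (h : Config Q L) {V : Submodule ℂ (MvPolynomial (Fin n) ℂ)}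
    (hV : V ≤ homogeneousSubmodule (Fin n) ℂ 1) {A P : MvPolynomial (Fin n) ℂ} (hA : A ∈ Q)
    (hAV : A ∈ V * V) (hP : P ∈ Q) (hPV : P ∉ V * V) :
    HasThird Q A P ∨ (∃ (γ : ℂ) (x : MvPolynomial (Fin n) ℂ), x.IsHomogeneous 1 ∧
      P = C γ * A + x ^ 2) ∨ ∃ R ∈ Q, SpecialTriple V A P R := by
  have hA' : A ∈ Q ∪ L := Finset.mem_union_left _ hA
  have hP' : P ∈ Q ∪ L := Finset.mem_union_left _ hP
  obtain ⟨B, hB, hBA, hBP, hv⟩ := h.third A hA' P hP' (fun hAP => hPV (hAP ▸ hAV))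
  rcases span_or_square_or_special hV hAV (h.irred A hA) (h.homQ hP) (h.irred P hP) hPV (h.hom B hB)
    hv with ⟨α, β, hs⟩ | hs | hs
  · rcases h.hasThird_or_square_of_span hA hP hB hBA hBP hs with h | ⟨γ, x, -, h⟩
    exacts [Or.inl h, Or.inr (Or.inl ⟨γ, x, h⟩)]
  · exact Or.inr (Or.inl hs)
  · rcases Finset.mem_union.1 hB with hB' | hB'
    · exact Or.inr (Or.inr ⟨B, hB', hs⟩)
    · obtain ⟨ℓ, hℓ, hBl⟩ := h.sq B hB'
      exact absurd (by rw [hBl, C_0]; ring) (hs.ne_add_sq hV hAV hAV hℓ 0).2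

/-- Lines through a point `P` outside a subspace `S` and two points of `S` do not share a third
point. -/
lemma eq_of_span_eq (h : Config Q L) {S : Submodule ℂ (MvPolynomial (Fin n) ℂ)}
    {A A' P B : MvPolynomial (Fin n) ℂ} (hA : A ∈ Q) (hA' : A' ∈ Q) (hAS : A ∈ S) (hAS' : A' ∈ S)
    (hPS : P ∉ S) {α β α' β' : ℂ} (hα : α ≠ 0) (hB : B = C α * A + C β * P)
    (hB' : B = C α' * A' + C β' * P) : A = A' := by
  by_cases hβ : β - β' = 0
  · refine h.eq_of_C_mul_eq (Finset.mem_union_left _ hA) (Finset.mem_union_left _ hA') hα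
      (c' := α') ?_
    rw [sub_eq_zero.1 hβ] at hB
    linear_combination hB' - hB
  · exfalso
    apply hPS
    have e : P = C (β - β')⁻¹ * (C α' * A' - C α * A) := by
      have := C_inv_mul_C (n := n) hβ
      rw [map_sub] at this
      linear_combination (-P) * this + C (β - β')⁻¹ * (hB' - hB)
    rw [e]
    exact C_mul_mem _ (S.sub_mem (C_mul_mem _ hAS') (C_mul_mem _ hAS))

/-- The squares joining `P` to members over `V`. -/
lemma eq_of_square (h : Config Q L) {V : Submodule ℂ (MvPolynomial (Fin n) ℂ)}
    (hV : V ≤ homogeneousSubmodule (Fin n) ℂ 1) {A A' P x x' : MvPolynomial (Fin n) ℂ}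
    (hA : A ∈ Q) (hA' : A' ∈ Q) (hAV : A ∈ V * V) (hAV' : A' ∈ V * V) (hP : P ∈ Q)
    (hPV : P ∉ V * V) (hx : x.IsHomogeneous 1) (hx' : x'.IsHomogeneous 1) {γ γ' : ℂ}
    (hs : P = C γ * A + x ^ 2) (hs' : P = C γ' * A' + x' ^ 2) : A = A' := by
  have hγ : γ ≠ 0 := by
    rintro rfl
    rw [C_0, zero_mul, zero_add] at hs
    exact not_irreducible_sq hx (hs ▸ h.irred P hP)
  have e : x ^ 2 - x' ^ 2 = C γ' * A' - C γ * A := by linear_combination hs' - hs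
  by_cases h0 : x ^ 2 - x' ^ 2 = 0
  · exact h.eq_of_C_mul_eq (Finset.mem_union_left _ hA) (Finset.mem_union_left _ hA') hγ
      (c' := γ') (by linear_combination e - h0)
  · exfalso
    have hxV := mem_of_sq_sub_sq_mem hV hx hx'
      (by rw [e]; exact (V * V).sub_mem (C_mul_mem _ hAV') (C_mul_mem _ hAV)) h0
    apply hPV
    rw [hs, pow_two]
    exact (V * V).add_mem (C_mul_mem _ hAV) (Submodule.mul_mem_mul hxV hxV)

lemma card_over_le (h : Config Q L) {V : Submodule ℂ (MvPolynomial (Fin n) ℂ)}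
    (hV : V ≤ homogeneousSubmodule (Fin n) ℂ 1) {P : MvPolynomial (Fin n) ℂ} (hP : P ∈ Q)
    (hPV : P ∉ V * V) :
    (Q.filter (· ∈ V * V)).card ≤ 2 * (Q.filter (· ∉ V * V)).card + 1 := by
  have hsub : Q.filter (· ∈ V * V) ⊆
      ((Q.filter (· ∈ V * V)).filter (fun A => HasThird Q A P) ∪
      (Q.filter (· ∈ V * V)).filter (fun A => ∃ R ∈ Q, SpecialTriple V A P R)) ∪
      (Q.filter (· ∈ V * V)).filter (fun A => ∃ (γ : ℂ) (x : MvPolynomial (Fin n) ℂ),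
        x.IsHomogeneous 1 ∧ P = C γ * A + x ^ 2) := by
    intro A hA
    have hA' := Finset.mem_filter.1 hA
    simp only [Finset.mem_union, Finset.mem_filter (p := fun A => HasThird Q A P), Finset.mem_filter
      (p := fun A => ∃ R ∈ Q, SpecialTriple V A P R), Finset.mem_filter (p := fun A => ∃ (γ : ℂ)
      (x : MvPolynomial (Fin n) ℂ), x.IsHomogeneous 1 ∧ P = C γ * A + x ^ 2)]
    rcases h.pair_over hV hA'.1 hA'.2 hP hPV with h | h | h
    exacts [Or.inl (Or.inl ⟨hA, h⟩), Or.inr ⟨hA, h⟩, Or.inl (Or.inr ⟨hA, h⟩)]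
  have c1 : ((Q.filter (· ∈ V * V)).filter (fun A => HasThird Q A P)).card ≤
      (Q.filter (· ∉ V * V)).card := by
    refine Finset.card_le_card_of_forall_subsingleton
      (fun A B => ∃ α β : ℂ, α ≠ 0 ∧ B = C α * A + C β * P) (fun A hA => ?_)
      (fun B hB A hA A' hA' => ?_)
    · obtain ⟨hA, B, hB, hBA, hBP, α, β, hs⟩ := Finset.mem_filter.1 hA
      obtain ⟨hA, hAV⟩ := Finset.mem_filter.1 hA
      obtain ⟨hα, hβ⟩ := h.coeff_ne_zero hA hP (Finset.mem_union_left _ hB) hBA hBP hs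
      refine ⟨B, Finset.mem_filter.2 ⟨hB, fun hBV => hPV ?_⟩, α, β, hα, hs⟩
      have e : P = C β⁻¹ * (B - C α * A) := by
        rw [hs]; linear_combination (-P) * C_inv_mul_C hβ
      rw [e]
      exact C_mul_mem _ ((V * V).sub_mem hBV (C_mul_mem _ hAV))
    · obtain ⟨hA, α, β, hα, hs⟩ := hA
      obtain ⟨hA', α', β', -, hs'⟩ := hA'
      obtain ⟨hA, hAV⟩ := Finset.mem_filter.1 (Finset.mem_filter.1 hA).1
      obtain ⟨hA', hAV'⟩ := Finset.mem_filter.1 (Finset.mem_filter.1 hA').1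
      exact h.eq_of_span_eq hA hA' hAV hAV' hPV hα hs hs'
  have c2 : ((Q.filter (· ∈ V * V)).filter (fun A => ∃ R ∈ Q, SpecialTriple V A P R)).card ≤
      (Q.filter (· ∉ V * V)).card := by
    refine Finset.card_le_card_of_forall_subsingleton
      (fun A R => SpecialTriple V A P R) (fun A hA => ?_) (fun R hR A hA A' hA' => ?_)
    · obtain ⟨hA, R, hR, hs⟩ := Finset.mem_filter.1 hA
      exact ⟨R, Finset.mem_filter.2 ⟨hR, hs.notMem hV (Finset.mem_filter.1 hA).2⟩, hs⟩
    · obtain ⟨hA, hs⟩ := hA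
      obtain ⟨hA', hs'⟩ := hA'
      obtain ⟨hA, hAV⟩ := Finset.mem_filter.1 (Finset.mem_filter.1 hA).1
      obtain ⟨hA', hAV'⟩ := Finset.mem_filter.1 (Finset.mem_filter.1 hA').1
      obtain ⟨c, hc⟩ := hs.eq_of_eq hV hAV (h.irred A hA) hAV' hs'
      exact h.eq_of_eq_C_mul (Finset.mem_union_left _ hA) (Finset.mem_union_left _ hA') hc
  have c3 : ((Q.filter (· ∈ V * V)).filter (fun A => ∃ (γ : ℂ) (x : MvPolynomial (Fin n) ℂ),
        x.IsHomogeneous 1 ∧ P = C γ * A + x ^ 2)).card ≤ 1 := by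
    refine Finset.card_le_one.2 fun A hA A' hA' => ?_
    obtain ⟨hA, γ, x, hx, hs⟩ := Finset.mem_filter.1 hA
    obtain ⟨hA', γ', x', hx', hs'⟩ := Finset.mem_filter.1 hA'
    obtain ⟨hA, hAV⟩ := Finset.mem_filter.1 hA
    obtain ⟨hA', hAV'⟩ := Finset.mem_filter.1 hA'
    exact h.eq_of_square hV hA hA' hAV hAV' hP hPV hx hx' hs hs'
  have := Finset.card_le_card hsub
  have u1 := Finset.card_union_le
    ((Q.filter (· ∈ V * V)).filter (fun A => HasThird Q A P) ∪
      (Q.filter (· ∈ V * V)).filter (fun A => ∃ R ∈ Q, SpecialTriple V A P R))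
      ((Q.filter (· ∈ V * V)).filter (fun A => ∃ (γ : ℂ) (x : MvPolynomial (Fin n) ℂ),
        x.IsHomogeneous 1 ∧ P = C γ * A + x ^ 2))
  have u2 := Finset.card_union_le
    ((Q.filter (· ∈ V * V)).filter (fun A => HasThird Q A P))
      ((Q.filter (· ∈ V * V)).filter (fun A => ∃ R ∈ Q, SpecialTriple V A P R))
  omega

/-- If two bad members are quadratics over `V`, then so are all members. -/
lemma mem_mul_of_bad (h : Config Q L) {V : Submodule ℂ (MvPolynomial (Fin n) ℂ)}
    (hV : V ≤ homogeneousSubmodule (Fin n) ℂ 1) {Q1 Q2 : MvPolynomial (Fin n) ℂ}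
    (h1 : Q1 ∈ Q) (h2 : Q2 ∈ Q) (hne : Q1 ≠ Q2) (hb1 : IsBad Q Q1) (hb2 : IsBad Q Q2)
    (hV1 : Q1 ∈ V * V) (hV2 : Q2 ∈ V * V) : ∀ P ∈ Q, P ∈ V * V := by
  by_contra hcon
  push Not at hcon
  obtain ⟨P0, hP0, hPV0⟩ := hcon
  have k1 := card_lineSet_lt hb1
  have k2 := card_lineSet_lt hb2
  have k3 := h.card_over_le hV hP0 hPV0
  have k4 := Finset.card_filter_add_card_filter_not (s := Q) (p := (· ∈ V * V))
  have k5 : 0 < (Q.filter (· ∉ V * V)).card :=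
    Finset.card_pos.2 ⟨P0, Finset.mem_filter.2 ⟨hP0, hPV0⟩⟩
  set Sp := Q.filter fun P => P ∉ V * V ∧ P ∉ lineSet Q Q1 ∧ ∃ R ∈ Q, SpecialTriple V Q1 P R
    with hSp
  have k6 : Q.filter (· ∉ V * V) ⊆ (lineSet Q Q1 ∪ lineSet Q Q2) ∪ Sp := by
    intro P hP
    obtain ⟨hP, hPV⟩ := Finset.mem_filter.1 hP
    rw [Finset.mem_union, Finset.mem_union, or_iff_not_imp_left, not_or]
    rintro ⟨n1, n2⟩
    have hs1 := (h.pair_over hV h1 hV1 hP hPV).resolve_left fun ht =>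
      n1 (Finset.mem_filter.2 ⟨hP, fun e => hPV (e ▸ hV1), ht⟩)
    have hs2 := (h.pair_over hV h2 hV2 hP hPV).resolve_left fun ht =>
      n2 (Finset.mem_filter.2 ⟨hP, fun e => hPV (e ▸ hV2), ht⟩)
    rcases hs1 with ⟨γ, x, hx, hs⟩ | hs
    · exfalso
      rcases hs2 with ⟨γ', x', hx', hs'⟩ | ⟨R, -, hs'⟩
      · exact hne (h.eq_of_square hV h1 h2 hV1 hV2 hP hPV hx hx' hs hs')
      · exact (hs'.ne_add_sq hV hV2 hV1 hx γ).1 hs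
    · exact Finset.mem_filter.2 ⟨hP, hPV, n1, hs⟩
  have k7 : Sp.card * 1 ≤ (lineSet Q Q1).card * 2 := by
    refine Finset.card_mul_le_card_mul (fun P R => SpecialTriple V Q1 P R) (fun P hP => ?_)
      fun R hR => ?_
    · obtain ⟨hP, hPV, hPl, R, hR, hs⟩ := Finset.mem_filter.1 hP
      have hRV := hs.notMem hV hV1
      rw [Nat.one_le_iff_ne_zero, ← Nat.pos_iff_ne_zero, Finset.card_pos]
      refine ⟨R, (Finset.mem_bipartiteAbove _).2 ⟨Finset.mem_filter.2 ⟨hR, fun e => hRV (e ▸ hV1), ?_⟩,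
        hs⟩⟩
      rcases h.pair_over hV h1 hV1 hR hRV with ht | ⟨γ, x, hx, ht⟩ | ⟨R', -, ht⟩
      · exact ht
      · exact absurd ht (hs.ne_add_sq hV hV1 hV1 hx γ).2
      · exact absurd ht (hs.not_special_third hV hV1 (h.irred _ h1))
    · by_contra hlt
      push Not at hlt
      obtain ⟨P, P', P'', hP, hP', hP'', n1, n2, n3⟩ := Finset.two_lt_card_iff.1 hlt
      obtain ⟨hP, hs⟩ := (Finset.mem_bipartiteBelow _).1 hP
      obtain ⟨hP', hs'⟩ := (Finset.mem_bipartiteBelow _).1 hP'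
      obtain ⟨hP'', hs''⟩ := (Finset.mem_bipartiteBelow _).1 hP''
      have key : ∀ P ∈ Sp, ∀ P' ∈ Sp, P ≠ P' → ¬ ∃ α β : ℂ, P' = C α * Q1 + C β * P := by
        intro P hP P' hP' hPP hs
        obtain ⟨hP, hPV, hPl, -⟩ := Finset.mem_filter.1 hP
        obtain ⟨hP', hPV', -⟩ := Finset.mem_filter.1 hP'
        exact hPl (Finset.mem_filter.2 ⟨hP, fun e => hPV (e ▸ hV1), P', hP',
          fun e => hPV' (e ▸ hV1), hPP.symm, hs⟩)
      rcases hs.span_of_three hV hV1 (h.irred _ h1) hs' hs'' with ht | ht | ht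
      exacts [key _ hP _ hP' n1 ht, key _ hP _ hP'' n2 ht, key _ hP' _ hP'' n3 ht]
  have k8 := Finset.card_le_card k6
  have u1 := Finset.card_union_le (lineSet Q Q1 ∪ lineSet Q Q2) Sp
  have u2 := Finset.card_union_le (lineSet Q Q1) (lineSet Q Q2)
  omega

end Config

/-- The span of a list of polynomials. -/
noncomputable def spanList (l : List (MvPolynomial (Fin n) ℂ)) : Submodule ℂ (MvPolynomial (Fin n) ℂ) :=
  Submodule.span ℂ {x | x ∈ l}

lemma mem_spanList {l : List (MvPolynomial (Fin n) ℂ)} {x : MvPolynomial (Fin n) ℂ} (hx : x ∈ l) :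
    x ∈ spanList l :=
  Submodule.subset_span hx

lemma spanList_le {l : List (MvPolynomial (Fin n) ℂ)} (hl : ∀ x ∈ l, x.IsHomogeneous 1) :
    spanList l ≤ homogeneousSubmodule (Fin n) ℂ 1 :=
  Submodule.span_le.2 hl

lemma finrank_spanList_le (l : List (MvPolynomial (Fin n) ℂ)) :
    Module.finrank ℂ (spanList l) ≤ l.length := by
  have h := finrank_span_finset_le_card (R := ℂ) l.toFinset
  rw [List.coe_toFinset] at h
  exact h.trans l.toFinset_card_le

lemma mul_mem_spanList {l : List (MvPolynomial (Fin n) ℂ)} {x y : MvPolynomial (Fin n) ℂ}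
    (hx : x ∈ l) (hy : y ∈ l) : x * y ∈ spanList l * spanList l :=
  Submodule.mul_mem_mul (mem_spanList hx) (mem_spanList hy)

/-- Some set of at most nine linear forms expresses both `A` and `B`. -/
def FewForms (A B : MvPolynomial (Fin n) ℂ) : Prop :=
  ∃ l : List (MvPolynomial (Fin n) ℂ), l.length ≤ 9 ∧ (∀ x ∈ l, x.IsHomogeneous 1) ∧
    A ∈ spanList l * spanList l ∧ B ∈ spanList l * spanList l

lemma mem_of_C_mul_mem {S : Submodule ℂ (MvPolynomial (Fin n) ℂ)} {c : ℂ} (hc : c ≠ 0)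
    {P : MvPolynomial (Fin n) ℂ} (h : C c * P ∈ S) : P ∈ S := by
  have e : P = C c⁻¹ * (C c * P) := by linear_combination (-P) * C_inv_mul_C hc
  rw [e]
  exact C_mul_mem _ h

/-- The forms occurring in two decompositions over pairs of linear forms. -/
lemma fewForms_of_commonIdeal_commonIdeal {A B P : MvPolynomial (Fin n) ℂ} (hA : CommonIdeal A P)
    (hB : CommonIdeal B P) : FewForms A B := by
  obtain ⟨a, b, ha, hb, ⟨c, d, hc, hd, rfl⟩, -⟩ := hA
  obtain ⟨a', b', ha', hb', ⟨c', d', hc', hd', rfl⟩, -⟩ := hB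
  refine ⟨[a, b, c, d, a', b', c', d'], by simp, by simp [*], ?_, ?_⟩ <;>
  exact Submodule.add_mem _ (mul_mem_spanList (by simp) (by simp))
    (mul_mem_spanList (by simp) (by simp))

lemma fewForms_of_commonIdeal_square {A B P x : MvPolynomial (Fin n) ℂ} {γ : ℂ} (hγ : γ ≠ 0)
    (hx : x.IsHomogeneous 1) (hA : CommonIdeal A P) (hB : P = C γ * B + x ^ 2) :
    FewForms A B := by
  obtain ⟨a, b, ha, hb, ⟨c, d, hc, hd, rfl⟩, ⟨c', d', hc', hd', rfl⟩⟩ := hA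
  refine ⟨[a, b, c, d, c', d', x], by simp, by simp [*], ?_, mem_of_C_mul_mem hγ ?_⟩
  · exact Submodule.add_mem _ (mul_mem_spanList (by simp) (by simp))
      (mul_mem_spanList (by simp) (by simp))
  · have e : C γ * B = a * c' + b * d' - x * x := by linear_combination -hB
    rw [e]
    exact Submodule.sub_mem _ (Submodule.add_mem _ (mul_mem_spanList (by simp) (by simp))
      (mul_mem_spanList (by simp) (by simp))) (mul_mem_spanList (by simp) (by simp))

lemma FewForms.symm {A B : MvPolynomial (Fin n) ℂ} (h : FewForms A B) : FewForms B A := by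
  obtain ⟨l, h1, h2, h3, h4⟩ := h
  exact ⟨l, h1, h2, h4, h3⟩

/-- A quadratic expressible by few forms, together with a representation of `B` by `A` and
squares of two forms. -/
lemma fewForms_of_mem {A B a b : MvPolynomial (Fin n) ℂ} {l : List (MvPolynomial (Fin n) ℂ)}
    {α β : ℂ} (hβ : β ≠ 0) (hAB : C β * B = C α * A + a ^ 2 - b ^ 2) (hlen : l.length ≤ 9)
    (hl : ∀ x ∈ l, x.IsHomogeneous 1) (ha : a ∈ l) (hb : b ∈ l)
    (hA : A ∈ spanList l * spanList l) : FewForms A B := by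
  refine ⟨l, hlen, hl, hA, mem_of_C_mul_mem hβ ?_⟩
  rw [hAB, pow_two, pow_two]
  exact Submodule.sub_mem _ (Submodule.add_mem _ (C_mul_mem _ hA) (mul_mem_spanList ha ha))
    (mul_mem_spanList hb hb)

namespace Config

variable {Q L : Finset (MvPolynomial (Fin n) ℂ)}

/-- Outside the lines with a third point, members are joined to both `A` and `B` by squares. -/
lemma squares_of_notMem (h : Config Q L) {A B P : MvPolynomial (Fin n) ℂ} (hA : A ∈ Q) (hB : B ∈ Q)
    (hAB : ¬ FewForms A B) (hP : P ∈ Q) (hPA : P ≠ A) (hPB : P ≠ B) (hlA : P ∉ lineSet Q A)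
    (hlB : P ∉ lineSet Q B) :
    ∃ (α β : ℂ) (a b : MvPolynomial (Fin n) ℂ), α ≠ 0 ∧ β ≠ 0 ∧ a.IsHomogeneous 1 ∧
      b.IsHomogeneous 1 ∧ P = C α * A + a ^ 2 ∧ P = C β * B + b ^ 2 := by
  have h1 := (h.pair hA hP hPA.symm).resolve_left fun ht =>
    hlA (Finset.mem_filter.2 ⟨hP, hPA, ht⟩)
  have h2 := (h.pair hB hP hPB.symm).resolve_left fun ht =>
    hlB (Finset.mem_filter.2 ⟨hP, hPB, ht⟩)
  rcases h1 with ⟨α, a, hα, ha, h1⟩ | h1 <;> rcases h2 with ⟨β, b, hβ, hb, h2⟩ | h2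
  · exact ⟨α, β, a, b, hα, hβ, ha, hb, h1, h2⟩
  · exact absurd (fewForms_of_commonIdeal_square hα ha h2 h1).symm hAB
  · exact absurd (fewForms_of_commonIdeal_square hβ hb h1 h2) hAB
  · exact absurd (fewForms_of_commonIdeal_commonIdeal h1 h2) hAB

/-- The squares joining `A` to the members of `squares_of_notMem` have roots in a fixed plane. -/
lemma mem_span_pair_of_squares (h : Config Q L) {A B P P' a b a' b' : MvPolynomial (Fin n) ℂ}
    {α β α' β' : ℂ} (hA : A ∈ Q) (hB : B ∈ Q) (hne : A ≠ B) (hAB : ¬ FewForms A B)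
    (hα : α ≠ 0) (hβ : β ≠ 0) (hα' : α' ≠ 0)
    (ha : a.IsHomogeneous 1) (hb : b.IsHomogeneous 1)
    (ha' : a'.IsHomogeneous 1) (hb' : b'.IsHomogeneous 1) (h1 : P = C α * A + a ^ 2)
    (h2 : P = C β * B + b ^ 2) (h1' : P' = C α' * A + a' ^ 2) (h2' : P' = C β' * B + b' ^ 2) :
    a' ∈ spanList [a, b] := by
  have e : C β * B = C α * A + a ^ 2 - b ^ 2 := by linear_combination h1 - h2
  have e' : C β' * B = C α' * A + a' ^ 2 - b' ^ 2 := by linear_combination h1' - h2'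
  by_cases hd : α * β' - α' * β = 0
  · have hd' : (C α * C β' : MvPolynomial (Fin n) ℂ) = C α' * C β := by
      rw [← map_mul, ← map_mul, sub_eq_zero.1 hd]
    have hr : C α * (a' ^ 2 - b' ^ 2) = C α' * (a ^ 2 - b ^ 2) := by
      linear_combination C α' * e - C α * e' + B * hd'
    have hab : a ^ 2 - b ^ 2 ≠ 0 := by
      intro h0
      refine hne (h.eq_of_C_mul_eq (Finset.mem_union_left _ hA) (Finset.mem_union_left _ hB) hα
        (c' := β) ?_)
      linear_combination -e - h0
    refine mem_of_sq_sub_sq_mem (spanList_le (by simp [*])) ha' hb' (mem_of_C_mul_mem hα ?_) ?_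
    · rw [hr, pow_two, pow_two]
      exact C_mul_mem _ (Submodule.sub_mem _ (mul_mem_spanList (by simp) (by simp))
        (mul_mem_spanList (by simp) (by simp)))
    · intro h0
      rw [h0, mul_zero] at hr
      exact (mul_ne_zero (C_ne_zero.2 hα') hab) hr.symm
  · exfalso
    refine hAB (fewForms_of_mem (l := [a, b, a', b']) hβ e (by simp) (by simp [*]) (by simp)
      (by simp) (mem_of_C_mul_mem hd ?_))
    have e2 : C (α * β' - α' * β) * A = C β * (a' * a' - b' * b') - C β' * (a * a - b * b) := by
      rw [map_sub, map_mul, map_mul]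
      linear_combination C β * e' - C β' * e
    rw [e2]
    exact Submodule.sub_mem _ (C_mul_mem _ (Submodule.sub_mem _ (mul_mem_spanList (by simp)
      (by simp)) (mul_mem_spanList (by simp) (by simp)))) (C_mul_mem _ (Submodule.sub_mem _
      (mul_mem_spanList (by simp) (by simp)) (mul_mem_spanList (by simp) (by simp))))

lemma card_squares_le (h : Config Q L) {A B a b P : MvPolynomial (Fin n) ℂ} {α β : ℂ}
    {T : Finset (MvPolynomial (Fin n) ℂ)} (hAB : ¬ FewForms A B) (hβ : β ≠ 0)
    (ha : a.IsHomogeneous 1) (hb : b.IsHomogeneous 1) (e : C β * B = C α * A + a ^ 2 - b ^ 2)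
    (hTQ : T ⊆ Q)
    (hT : ∀ D ∈ T, ∃ (δ : ℂ) (d : MvPolynomial (Fin n) ℂ), δ ≠ 0 ∧ d ∈ spanList [a, b] ∧
      D = C δ * A + d ^ 2) (hP : P ∈ Q)
    (hPS : P ∉ Submodule.span ℂ {A} ⊔ spanList [a, b] * spanList [a, b]) :
    T.card ≤
      (Q.filter (· ∉ Submodule.span ℂ {A} ⊔ spanList [a, b] * spanList [a, b])).card + 1 := by
  set V := spanList [a, b] with hV
  have hVle : V ≤ homogeneousSubmodule (Fin n) ℂ 1 := spanList_le (by simp [*])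
  have hAS : A ∈ Submodule.span ℂ {A} ⊔ V * V :=
    Submodule.mem_sup_left (Submodule.mem_span_singleton_self A)
  have hsq : ∀ d ∈ V, d ^ 2 ∈ Submodule.span ℂ {A} ⊔ V * V := fun d hd =>
    Submodule.mem_sup_right (by rw [pow_two]; exact Submodule.mul_mem_mul hd hd)
  have hTS : ∀ D ∈ T, D ∈ Submodule.span ℂ {A} ⊔ V * V := by
    intro D hD
    obtain ⟨δ, d, -, hd, rfl⟩ := hT D hD
    exact Submodule.add_mem _ (C_mul_mem _ hAS) (hsq d hd)
  have hsub : T ⊆ T.filter (fun D => HasThird Q D P) ∪ T.filter (fun D =>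
      ∃ (γ : ℂ) (x : MvPolynomial (Fin n) ℂ), γ ≠ 0 ∧ x.IsHomogeneous 1 ∧
        P = C γ * D + x ^ 2) := by
    intro D hD
    rw [Finset.mem_union, Finset.mem_filter, Finset.mem_filter]
    rcases h.pair (hTQ hD) hP (fun hDP => hPS (hDP ▸ hTS D hD)) with ht | ht | ht
    · exact Or.inl ⟨hD, ht⟩
    · exact Or.inr ⟨hD, ht⟩
    · exfalso
      obtain ⟨δ, d, hδ, hd, hDd⟩ := hT D hD
      obtain ⟨p, q, hp, hq, ⟨r, s, hr, hs, hD'⟩, -⟩ := ht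
      have hdl : d.IsHomogeneous 1 := hVle hd
      refine hAB (fewForms_of_mem (l := [a, b, d, p, q, r, s]) hβ e (by simp) (by simp [*])
        (by simp) (by simp) (mem_of_C_mul_mem hδ ?_))
      have e2 : C δ * A = p * r + q * s - d * d := by linear_combination hD' - hDd
      rw [e2]
      exact Submodule.sub_mem _ (Submodule.add_mem _ (mul_mem_spanList (by simp) (by simp))
        (mul_mem_spanList (by simp) (by simp))) (mul_mem_spanList (by simp) (by simp))
  have c1 : (T.filter (fun D => HasThird Q D P)).card ≤
      (Q.filter (· ∉ Submodule.span ℂ {A} ⊔ V * V)).card := by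
    refine Finset.card_le_card_of_forall_subsingleton
      (fun D R => ∃ α β : ℂ, α ≠ 0 ∧ R = C α * D + C β * P) (fun D hD => ?_)
      (fun R hR D hD D' hD' => ?_)
    · obtain ⟨hD, R, hR, hRD, hRP, α, β, hs⟩ := Finset.mem_filter.1 hD
      obtain ⟨hα, hβ⟩ := h.coeff_ne_zero (hTQ hD) hP (Finset.mem_union_left _ hR) hRD hRP hs
      refine ⟨R, Finset.mem_filter.2 ⟨hR, fun hRS => hPS (mem_of_C_mul_mem hβ ?_)⟩, α, β, hα, hs⟩
      have e2 : C β * P = R - C α * D := by linear_combination -hs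
      rw [e2]
      exact Submodule.sub_mem _ hRS (C_mul_mem _ (hTS D hD))
    · obtain ⟨hD, α, β, hα, hs⟩ := hD
      obtain ⟨hD', α', β', -, hs'⟩ := hD'
      have hD := (Finset.mem_filter.1 hD).1
      have hD' := (Finset.mem_filter.1 hD').1
      exact h.eq_of_span_eq (hTQ hD) (hTQ hD') (hTS D hD) (hTS D' hD') hPS hα hs hs'
  have c2 : (T.filter (fun D => ∃ (γ : ℂ) (x : MvPolynomial (Fin n) ℂ), γ ≠ 0 ∧
      x.IsHomogeneous 1 ∧ P = C γ * D + x ^ 2)).card ≤ 1 := by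
    refine Finset.card_le_one.2 fun D hD D' hD' => ?_
    obtain ⟨hD, γ, x, hγ, hx, hs⟩ := Finset.mem_filter.1 hD
    obtain ⟨hD', γ', x', hγ', hx', hs'⟩ := Finset.mem_filter.1 hD'
    obtain ⟨δ, d, hδ, hd, hDd⟩ := hT D hD
    obtain ⟨δ', d', hδ', hd', hDd'⟩ := hT D' hD'
    have hdl : d.IsHomogeneous 1 := hVle hd
    have hdl' : d'.IsHomogeneous 1 := hVle hd'
    by_contra hne
    have e2 : C (γ' * δ' - γ * δ) * A =
        x * x - x' * x' + C γ * (d * d) - C γ' * (d' * d') := by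
      rw [map_sub, map_mul, map_mul]
      linear_combination hs - hs' + C γ * hDd - C γ' * hDd'
    by_cases h0 : γ' * δ' - γ * δ = 0
    · rw [h0, C_0, zero_mul] at e2
      have hxV : x ∈ V := by
        refine mem_of_sq_sub_sq_mem hVle hx hx' ?_ fun h1 => ?_
        · have e3 : x ^ 2 - x' ^ 2 = C γ' * (d' * d') - C γ * (d * d) := by
            linear_combination -e2
          rw [e3]
          exact Submodule.sub_mem _ (C_mul_mem _ (Submodule.mul_mem_mul hd' hd'))
            (C_mul_mem _ (Submodule.mul_mem_mul hd hd))
        · exact hne (h.eq_of_C_mul_eq (Finset.mem_union_left _ (hTQ hD))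
            (Finset.mem_union_left _ (hTQ hD')) hγ (c' := γ')
            (by linear_combination hs' - hs - h1))
      apply hPS
      rw [hs]
      exact Submodule.add_mem _ (C_mul_mem _ (hTS D hD)) (hsq x hxV)
    · refine hAB (fewForms_of_mem (l := [a, b, d, d', x, x']) hβ e (by simp) (by simp [*])
        (by simp) (by simp) (mem_of_C_mul_mem h0 ?_))
      rw [e2]
      exact Submodule.sub_mem _ (Submodule.add_mem _ (Submodule.sub_mem _
        (mul_mem_spanList (by simp) (by simp)) (mul_mem_spanList (by simp) (by simp)))
        (C_mul_mem _ (mul_mem_spanList (by simp) (by simp))))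
        (C_mul_mem _ (mul_mem_spanList (by simp) (by simp)))
  have := Finset.card_le_card hsub
  have u1 := Finset.card_union_le (T.filter (fun D => HasThird Q D P)) (T.filter (fun D =>
      ∃ (γ : ℂ) (x : MvPolynomial (Fin n) ℂ), γ ≠ 0 ∧ x.IsHomogeneous 1 ∧
        P = C γ * D + x ^ 2))
  omega

/-- If two bad members cannot be expressed by few linear forms, then all members are quadratics in
two forms up to multiples of the first bad member. -/
lemma exists_forms_of_not_fewForms (h : Config Q L) {A B : MvPolynomial (Fin n) ℂ} (hA : A ∈ Q)
    (hB : B ∈ Q) (hne : A ≠ B) (hbA : IsBad Q A) (hbB : IsBad Q B) (hAB : ¬ FewForms A B) :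
    ∃ l : List (MvPolynomial (Fin n) ℂ), l.length ≤ 9 ∧ (∀ x ∈ l, x.IsHomogeneous 1) ∧
      ∀ P ∈ Q, P ∈ Submodule.span ℂ {A} ⊔ spanList l * spanList l := by
  have kA := card_lineSet_lt hbA
  have kB := card_lineSet_lt hbB
  set T := Q.filter fun P => P ≠ A ∧ P ≠ B ∧ P ∉ lineSet Q A ∧ P ∉ lineSet Q B with hT
  have hQ : Q ⊆ ({A, B} ∪ (lineSet Q A ∪ lineSet Q B)) ∪ T := by
    intro P hP
    simp only [hT, Finset.mem_union, Finset.mem_filter, Finset.mem_insert, Finset.mem_singleton]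
    tauto
  have kQ := Finset.card_le_card hQ
  have u1 := Finset.card_union_le ({A, B} ∪ (lineSet Q A ∪ lineSet Q B)) T
  have u2 := Finset.card_union_le {A, B} (lineSet Q A ∪ lineSet Q B)
  have u3 := Finset.card_union_le (lineSet Q A) (lineSet Q B)
  have u4 := Finset.card_le_two (a := A) (b := B)
  have hsq : ∀ P ∈ T, _ := fun P hP =>
    have hP' := Finset.mem_filter.1 hP
    h.squares_of_notMem hA hB hAB hP'.1 hP'.2.1 hP'.2.2.1 hP'.2.2.2.1 hP'.2.2.2.2
  rcases T.eq_empty_or_nonempty with hT0 | ⟨P0, hP0⟩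
  · have hTc : T.card = 0 := by rw [hT0, Finset.card_empty]
    have z1 : (lineSet Q A).card = 0 := by omega
    have z2 : (lineSet Q B).card = 0 := by omega
    rw [Finset.card_eq_zero] at z1 z2
    rw [z1, z2, hT0] at hQ
    have hQ' : ∀ P ∈ Q, P = A ∨ P = B := fun P hP => by simpa using hQ hP
    rcases h.pair hA hB hne with ⟨R, hR, hRA, hRB, -⟩ | ⟨γ, x, -, hx, hs⟩ | hc
    · rcases hQ' R hR with h1 | h1
      exacts [absurd h1 hRA, absurd h1 hRB]
    · have hAS : A ∈ Submodule.span ℂ {A} ⊔ spanList [x] * spanList [x] :=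
        Submodule.mem_sup_left (Submodule.mem_span_singleton_self A)
      refine ⟨[x], by simp, by simp [hx], fun P hP => ?_⟩
      rcases hQ' P hP with rfl | rfl
      · exact hAS
      · rw [hs, pow_two]
        exact Submodule.add_mem _ (C_mul_mem _ hAS)
          (Submodule.mem_sup_right (mul_mem_spanList (by simp) (by simp)))
    · exfalso
      refine hAB (fewForms_of_commonIdeal_commonIdeal hc (P := B) ?_)
      obtain ⟨a, b, ha, hb, -, hB'⟩ := hc
      exact ⟨a, b, ha, hb, hB', hB'⟩
  · obtain ⟨α, β, a, b, hα, hβ, ha, hb, h1, h2⟩ := hsq P0 hP0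
    have e : C β * B = C α * A + a ^ 2 - b ^ 2 := by linear_combination h1 - h2
    have hTV : ∀ D ∈ T, ∃ (δ : ℂ) (d : MvPolynomial (Fin n) ℂ), δ ≠ 0 ∧ d ∈ spanList [a, b] ∧
        D = C δ * A + d ^ 2 := by
      intro D hD
      obtain ⟨α', β', a', b', hα', -, ha', hb', h1', h2'⟩ := hsq D hD
      exact ⟨α', a', hα', h.mem_span_pair_of_squares hA hB hne hAB hα hβ hα' ha hb ha' hb' h1 h2 h1'
        h2', h1'⟩
    refine ⟨[a, b], by simp, by simp [*], ?_⟩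
    by_contra hcon
    push Not at hcon
    obtain ⟨P, hP, hPS⟩ := hcon
    have k1 := h.card_squares_le (T := T) hAB hβ ha hb e (Finset.filter_subset _ _) hTV hP hPS
    have hAS : A ∈ Submodule.span ℂ {A} ⊔ spanList [a, b] * spanList [a, b] :=
      Submodule.mem_sup_left (Submodule.mem_span_singleton_self A)
    have hBS : B ∈ Submodule.span ℂ {A} ⊔ spanList [a, b] * spanList [a, b] := by
      refine mem_of_C_mul_mem hβ ?_
      rw [e, pow_two, pow_two]
      exact Submodule.sub_mem _ (Submodule.add_mem _ (C_mul_mem _ hAS)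
        (Submodule.mem_sup_right (mul_mem_spanList (by simp) (by simp))))
        (Submodule.mem_sup_right (mul_mem_spanList (by simp) (by simp)))
    have hsub : Q.filter (· ∉ Submodule.span ℂ {A} ⊔ spanList [a, b] * spanList [a, b]) ⊆
        lineSet Q A ∪ lineSet Q B := by
      intro D hD
      obtain ⟨hD, hDS⟩ := Finset.mem_filter.1 hD
      by_contra hDl
      rw [Finset.mem_union, not_or] at hDl
      obtain ⟨δ, d, -, hd, hDd⟩ := hTV D (Finset.mem_filter.2 ⟨hD, fun e => hDS (e ▸ hAS),
        fun e => hDS (e ▸ hBS), hDl.1, hDl.2⟩)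
      apply hDS
      rw [hDd, pow_two]
      exact Submodule.add_mem _ (C_mul_mem _ hAS)
        (Submodule.mem_sup_right (Submodule.mul_mem_mul hd hd))
    have k2 := Finset.card_le_card hsub
    have k3 : 0 < (Q.filter
        (· ∉ Submodule.span ℂ {A} ⊔ spanList [a, b] * spanList [a, b])).card :=
      Finset.card_pos.2 ⟨P, Finset.mem_filter.2 ⟨hP, hPS⟩⟩
    omega

end Config

lemma mul_self_le_span (V : Submodule ℂ (MvPolynomial (Fin n) ℂ)) :
    V * V ≤ Submodule.span ℂ {x | ∃ v ∈ V, ∃ w ∈ V, x = v * w} :=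
  Submodule.mul_le.2 fun v hv w hw => Submodule.subset_span ⟨v, hv, w, hw, rfl⟩

end QuadraticSG

/-- There is an absolute constant `C` such that the following holds. Let `𝒬 ∪ ℒ` be a
finite Sylvester–Gallai configuration of pairwise linearly independent homogeneous
quadratics, `𝒬` irreducible, `ℒ` squares of linear forms. If `𝒬` contains two distinct
bad polynomials `Q1, Q2`, then there is a subspace `V` of linear forms of dimension at
most `C` such that every element of `𝒬` is a linear combination of `Q1` and a quadratic
over `V`. -/
theorem stmt_15 :
    ∃ C : ℕ, ∀ (n : ℕ) (Q L : Finset (MvPolynomial (Fin n) ℂ)),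
      (∀ P ∈ Q ∪ L, P.IsHomogeneous 2) →
      (∀ P ∈ Q ∪ L, ∀ P' ∈ Q ∪ L, P ≠ P' → LinearIndependent ℂ ![P, P']) →
      (∀ P1 ∈ Q ∪ L, ∀ P2 ∈ Q ∪ L, P1 ≠ P2 → ∃ P3 ∈ Q ∪ L, P3 ≠ P1 ∧ P3 ≠ P2 ∧
        ∀ a : Fin n → ℂ, eval a P1 = 0 → eval a P2 = 0 → eval a P3 = 0) →
      (∀ P ∈ Q, Irreducible P) →
      (∀ P ∈ L, ∃ ℓ : MvPolynomial (Fin n) ℂ, ℓ.IsHomogeneous 1 ∧ P = ℓ ^ 2) →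
      ∀ Q1 ∈ Q, ∀ Q2 ∈ Q, Q1 ≠ Q2 → IsBad Q Q1 → IsBad Q Q2 →
      ∃ V : Submodule ℂ (MvPolynomial (Fin n) ℂ),
        V ≤ homogeneousSubmodule (Fin n) ℂ 1 ∧ Module.finrank ℂ ↥V ≤ C ∧
        ∀ P ∈ Q, P ∈ Submodule.span ℂ
          ({Q1} ∪ {x | ∃ v ∈ V, ∃ w ∈ V, x = v * w} :
            Set (MvPolynomial (Fin n) ℂ)) := by
  refine ⟨9, fun n Q L hom indep third irred sq Q1 h1 Q2 h2 hne hb1 hb2 => ?_⟩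
  have h : QuadraticSG.Config Q L := ⟨hom, indep, third, irred, sq⟩
  obtain ⟨l, hlen, hl, hspan⟩ : ∃ l : List (MvPolynomial (Fin n) ℂ), l.length ≤ 9 ∧
      (∀ x ∈ l, x.IsHomogeneous 1) ∧
      ∀ P ∈ Q, P ∈ Submodule.span ℂ {Q1} ⊔ QuadraticSG.spanList l * QuadraticSG.spanList l := by
    by_cases hfew : QuadraticSG.FewForms Q1 Q2
    · obtain ⟨l, hlen, hl, hl1, hl2⟩ := hfew
      exact ⟨l, hlen, hl, fun P hP => Submodule.mem_sup_right
        (h.mem_mul_of_bad (QuadraticSG.spanList_le hl) h1 h2 hne hb1 hb2 hl1 hl2 P hP)⟩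
    · exact h.exists_forms_of_not_fewForms h1 h2 hne hb1 hb2 hfew
  refine ⟨QuadraticSG.spanList l, QuadraticSG.spanList_le hl,
    (QuadraticSG.finrank_spanList_le l).trans hlen, fun P hP => ?_⟩
  rw [Submodule.span_union]
  exact sup_le_sup_left (QuadraticSG.mul_self_le_span _) _ (hspan P hP)
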